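/- Let 𝒜 be a homogeneous constant-coefficient linear differential operator of order k from ℝ^d-valued to ℝ^N-valued functions on ℝⁿ having constant rank in ℝ. Then for every non-empty compact set K ⊆ ℝ^d and all exponents 1 < p < q < ∞, the p- and q-𝒜-quasiconvex hulls of K coincide: K^(p) = K^(q). -/

import Mathlib

/-!
Constant-rank homogeneous differential operators.

A homogeneous constant-coefficient linear differential operator `𝒜` of order
`k` from `ℝ^d`-valued to `ℝ^N`-valued functions on `ℝⁿ` is encoded by its
family of coefficients `A α : ℝ^d →ₗ ℝ^N`, indexed by ordered tuples
`α : Fin k → Fin n` of coordinate directions (so that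
`𝒜u = Σ_α A α (∂_{α 0} ⋯ ∂_{α (k-1)} u)`, an equivalent presentation of the
usual multi-index form).  The torus `𝕋ⁿ = ℝⁿ/ℤⁿ` is encoded via
`ℤⁿ`-periodic functions on `ℝⁿ`, with the unit cube as fundamental domain.
-/

noncomputable section
open MeasureTheory
open scoped ENNReal

/-- Euclidean `ℝ^d`. -/
abbrev Ed (d : ℕ) : Type := EuclideanSpace ℝ (Fin d)

/-- The underlying space `ℝⁿ` of the torus `𝕋ⁿ = ℝⁿ/ℤⁿ`. -/
abbrev Dom (n : ℕ) : Type := Fin n → ℝ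

/-- The fundamental domain `[0,1)ⁿ` of the torus. -/
def unitBox (n : ℕ) : Set (Dom n) := Set.univ.pi fun _ => Set.Ico (0 : ℝ) 1

/-- `ℤⁿ`-periodicity: the defining property of functions on the torus. -/
def PeriodicZ {n : ℕ} {E : Type*} (f : Dom n → E) : Prop :=
  ∀ (x : Dom n) (m : Fin n → ℤ), f (x + fun i => (m i : ℝ)) = f x

/-- The Fourier symbol `𝒜[ξ] = Σ_α (Π_i ξ_{α i}) A α : ℝ^d →ₗ ℝ^N`. -/
def opSymbol {n d N k : ℕ} (A : (Fin k → Fin n) → (Ed d →ₗ[ℝ] Ed N))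
    (ξ : Fin n → ℝ) : Ed d →ₗ[ℝ] Ed N :=
  ∑ α : Fin k → Fin n, (∏ i, ξ (α i)) • A α

/-- `𝒜` has constant rank (in `ℝ`): the rank of `𝒜[ξ]` is independent of
`ξ ∈ ℝⁿ \ {0}`. -/
def HasConstantRank {n d N k : ℕ}
    (A : (Fin k → Fin n) → (Ed d →ₗ[ℝ] Ed N)) : Prop :=
  ∃ r : ℕ, ∀ ξ : Fin n → ℝ, ξ ≠ 0 →
    Module.finrank ℝ (LinearMap.range (opSymbol A ξ)) = r

/-- The differential operator `𝒜` applied (pointwise) to a `C^k` map: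
`𝒜u(x) = Σ_α A α (∂^α u (x))`. -/
def opApply {n d N k : ℕ} (A : (Fin k → Fin n) → (Ed d →ₗ[ℝ] Ed N))
    (u : Dom n → Ed d) (x : Dom n) : Ed N :=
  ∑ α : Fin k → Fin n,
    A α (iteratedFDeriv ℝ k u x fun i => Pi.single (α i) 1)

/-- The test class `𝒯_𝒜`: smooth maps `φ : 𝕋ⁿ → ℝ^d` with zero mean and
`𝒜φ = 0`. -/
def opTestClass {n d N k : ℕ} (A : (Fin k → Fin n) → (Ed d →ₗ[ℝ] Ed N)) :
    Set (Dom n → Ed d) :=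
  {φ | ContDiff ℝ (⊤ : ℕ∞) φ ∧ PeriodicZ φ ∧ (∀ x, opApply A φ x = 0) ∧
    (∫ x in unitBox n, φ x) = 0}

/-- The `𝒜`-quasiconvex envelope
`𝒬_𝒜 F(ξ) = inf { ∫_{𝕋ⁿ} F(ξ + φ(x)) dx : φ ∈ 𝒯_𝒜 }`. -/
def opEnvelope {n d N k : ℕ} (A : (Fin k → Fin n) → (Ed d →ₗ[ℝ] Ed N))
    (F : Ed d → ℝ) (ξ : Ed d) : ℝ :=
  sInf ((fun φ : Dom n → Ed d => ∫ x in unitBox n, F (ξ + φ x)) '' opTestClass A)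

/-- The `p`-`𝒜`-quasiconvex hull `K^(p) = { ξ : 𝒬_𝒜 f_p (ξ) = 0 }` with
`f_p(ξ) = dist(ξ, K)^p`. -/
def opHull {n d N k : ℕ} (A : (Fin k → Fin n) → (Ed d →ₗ[ℝ] Ed N))
    (K : Set (Ed d)) (p : ℝ) : Set (Ed d) :=
  {ξ | opEnvelope A (fun η => Metric.infDist η K ^ p) ξ = 0}

section

open Filter Topology Complex

/-! ### Integration over the unit box -/

/-- Lebesgue measure restricted to the unit box. -/
abbrev boxVol (n : ℕ) : Measure (Dom n) := volume.restrict (unitBox n)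

lemma measurableSet_unitBox (n : ℕ) : MeasurableSet (unitBox n) :=
  MeasurableSet.univ_pi fun _ => measurableSet_Ico

instance isProbabilityMeasure_boxVol (n : ℕ) : IsProbabilityMeasure (boxVol n) := by
  constructor
  simp [unitBox, Real.volume_pi_Ico]

lemma unitBox_subset_Icc (n : ℕ) : unitBox n ⊆ Set.Icc (0 : Dom n) 1 := by
  intro x hx
  rw [unitBox, Set.mem_univ_pi] at hx
  exact ⟨fun i => (hx i).1, fun i => (hx i).2.le⟩

lemma Continuous.integrable_box {n : ℕ} {E : Type*} [NormedAddCommGroup E] {f : Dom n → E}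
    (hf : Continuous f) : Integrable f (boxVol n) :=
  (hf.continuousOn.integrableOn_compact isCompact_Icc).mono_set (unitBox_subset_Icc n)

lemma Continuous.exists_box_bound {n : ℕ} {E : Type*} [NormedAddCommGroup E] {f : Dom n → E}
    (hf : Continuous f) : ∃ C, 0 ≤ C ∧ ∀ x ∈ unitBox n, ‖f x‖ ≤ C := by
  obtain ⟨C, hC⟩ := (isCompact_Icc (a := (0 : Dom n)) (b := 1)).exists_bound_of_continuousOn
    hf.continuousOn
  exact ⟨max C 0, le_max_right _ _, fun x hx =>
    (hC x (unitBox_subset_Icc n hx)).trans (le_max_left _ _)⟩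

lemma Continuous.memLp_box {n : ℕ} {E : Type*} [NormedAddCommGroup E] {f : Dom n → E}
    (hf : Continuous f) (p : ℝ≥0∞) : MemLp f p (boxVol n) := by
  obtain ⟨C, -, hC⟩ := hf.exists_box_bound
  refine MemLp.of_bound (hf.integrable_box).aestronglyMeasurable C ?_
  exact (ae_restrict_iff' (measurableSet_unitBox n)).2 (Eventually.of_forall hC)

/-- The `L^r` norm over the unit box. -/
def boxNorm {n : ℕ} {E : Type*} [NormedAddCommGroup E] (r : ℝ) (f : Dom n → E) : ℝ :=
  (∫ x in unitBox n, ‖f x‖ ^ r) ^ r⁻¹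

section boxNorm

variable {n : ℕ} {E : Type*} [NormedAddCommGroup E] {r : ℝ}

lemma boxNorm_nonneg (f : Dom n → E) : 0 ≤ boxNorm r f :=
  Real.rpow_nonneg (integral_nonneg fun _ => by positivity) _

lemma boxNorm_eq_lpNorm (hr : 0 < r) {f : Dom n → E} (hf : Continuous f) :
    boxNorm r f = lpNorm f (ENNReal.ofReal r) (boxVol n) := by
  rw [lpNorm_eq_integral_norm_rpow_toReal (by simpa using hr) (by simp)
    hf.integrable_box.aestronglyMeasurable, ENNReal.toReal_ofReal hr.le, boxNorm]

lemma boxNorm_rpow (hr : 0 < r) (f : Dom n → E) :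
    boxNorm r f ^ r = ∫ x in unitBox n, ‖f x‖ ^ r := by
  rw [boxNorm, Real.rpow_inv_rpow (integral_nonneg fun _ => by positivity) hr.ne']

lemma boxNorm_add_le (hr : 1 ≤ r) {f g : Dom n → E} (hf : Continuous f) (hg : Continuous g) :
    boxNorm r (fun x => f x + g x) ≤ boxNorm r f + boxNorm r g := by
  have h0 : 0 < r := by linarith
  rw [boxNorm_eq_lpNorm h0 hf, boxNorm_eq_lpNorm h0 hg,
    boxNorm_eq_lpNorm h0 (f := fun x => f x + g x) (hf.add hg)]
  exact lpNorm_add_le (hf.memLp_box _) (by simpa using hr)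

lemma boxNorm_mono {F : Type*} [NormedAddCommGroup F] (hr : 0 < r) {f : Dom n → E}
    {g : Dom n → F} (hf : Continuous f) (hg : Continuous g) (h : ∀ x, ‖f x‖ ≤ ‖g x‖) :
    boxNorm r f ≤ boxNorm r g := by
  refine Real.rpow_le_rpow (integral_nonneg fun _ => by positivity) ?_ (by positivity)
  refine integral_mono (hf.norm.rpow_const fun _ => Or.inr hr.le).integrable_box
    (hg.norm.rpow_const fun _ => Or.inr hr.le).integrable_box fun x => ?_
  exact Real.rpow_le_rpow (norm_nonneg _) (h x) hr.le

lemma boxNorm_norm (f : Dom n → E) : boxNorm r (fun x => ‖f x‖) = boxNorm r f := by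
  simp [boxNorm]

lemma boxNorm_const (hr : 0 < r) (c : E) : boxNorm r (fun _ : Dom n => c) = ‖c‖ := by
  have : (∫ x in unitBox n, ‖c‖ ^ r) = ‖c‖ ^ r := by simp
  rw [boxNorm, this, Real.rpow_rpow_inv (norm_nonneg _) hr.ne']

lemma boxNorm_le_of_bound (hr : 0 < r) {f : Dom n → E} (hf : Continuous f) {C : ℝ}
    (hC : 0 ≤ C) (h : ∀ x, ‖f x‖ ≤ C) : boxNorm r f ≤ C := by
  calc boxNorm r f ≤ boxNorm r (fun _ : Dom n => C) :=
        boxNorm_mono hr hf continuous_const fun x => (h x).trans (le_abs_self C)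
    _ = C := by rw [boxNorm_const hr, Real.norm_of_nonneg hC]

lemma boxNorm_const_mul (hr : 0 < r) (c : ℂ) (f : Dom n → ℂ) :
    boxNorm r (fun x => c * f x) = ‖c‖ * boxNorm r f := by
  unfold boxNorm
  have : ∀ x, ‖c * f x‖ ^ r = ‖c‖ ^ r * ‖f x‖ ^ r := fun x => by
    rw [norm_mul, Real.mul_rpow (norm_nonneg _) (norm_nonneg _)]
  simp_rw [this]
  rw [integral_const_mul, Real.mul_rpow (by positivity)
    (integral_nonneg fun _ => by positivity), Real.rpow_rpow_inv (norm_nonneg _) hr.ne']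

lemma boxNorm_zero (hr : 0 < r) : boxNorm r (fun _ : Dom n => (0 : E)) = 0 := by
  rw [boxNorm_const hr, norm_zero]

lemma boxNorm_sum_le (hr : 1 ≤ r) {ι : Type*} (s : Finset ι) {f : ι → Dom n → E}
    (hf : ∀ i, Continuous (f i)) :
    boxNorm r (fun x => ∑ i ∈ s, f i x) ≤ ∑ i ∈ s, boxNorm r (f i) := by
  classical
  induction s using Finset.induction_on with
  | empty => simp [boxNorm_zero (show 0 < r by linarith)]
  | insert a s ha ih =>
    simp only [Finset.sum_insert ha]
    refine (boxNorm_add_le hr (hf a) (continuous_finsetSum _ fun i _ => hf i)).trans ?_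
    gcongr

lemma boxNorm_le_of_exponent_le (hr : 0 < r) {s : ℝ} (hrs : r ≤ s) {f : Dom n → E}
    (hf : Continuous f) : boxNorm r f ≤ boxNorm s f := by
  have hm := hf.integrable_box.aestronglyMeasurable
  rw [boxNorm_eq_lpNorm hr hf, boxNorm_eq_lpNorm (hr.trans_le hrs) hf, ← toReal_eLpNorm hm,
    ← toReal_eLpNorm hm]
  exact ENNReal.toReal_mono (hf.memLp_box _).eLpNorm_ne_top
    (eLpNorm_le_eLpNorm_of_exponent_le (ENNReal.ofReal_le_ofReal hrs) hm)

lemma norm_integral_mul_le_boxNorm {p p' : ℝ} (h : p.HolderConjugate p') {f g : Dom n → ℂ}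
    (hf : Continuous f) (hg : Continuous g) :
    ‖∫ x in unitBox n, f x * g x‖ ≤ boxNorm p f * boxNorm p' g := by
  refine (norm_integral_le_integral_norm _).trans ?_
  simp_rw [norm_mul]
  have := integral_mul_le_Lp_mul_Lq_of_nonneg (μ := boxVol n) h (f := fun x => ‖f x‖)
    (g := fun x => ‖g x‖)
    (Eventually.of_forall fun _ => norm_nonneg _) (Eventually.of_forall fun _ => norm_nonneg _)
    (hf.norm.memLp_box _) (hg.norm.memLp_box _)
  simpa [boxNorm] using this

lemma norm_integral_le_boxNorm (hr : 1 ≤ r) {f : Dom n → ℂ} (hf : Continuous f) :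
    ‖∫ x in unitBox n, f x‖ ≤ boxNorm r f := by
  refine (norm_integral_le_integral_norm _).trans ?_
  refine le_trans (le_of_eq ?_) (boxNorm_le_of_exponent_le one_pos hr hf)
  simp [boxNorm]

/-- Interpolation at the arithmetic mean of two exponents. -/
lemma integral_rpow_midpoint_le {p s : ℝ} (hp : 0 < p) (hs : 0 < s) {f : Dom n → E}
    (hf : Continuous f) :
    (∫ x in unitBox n, ‖f x‖ ^ ((p + s) / 2)) ≤
      boxNorm p f ^ (p / 2) * boxNorm s f ^ (s / 2) := by
  have hc : ∀ t : ℝ, 0 < t → Continuous fun x => ‖f x‖ ^ t := fun t ht =>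
    hf.norm.rpow_const fun _ => Or.inr ht.le
  have := integral_mul_le_Lp_mul_Lq_of_nonneg (μ := boxVol n) Real.HolderConjugate.two_two
    (f := fun x => ‖f x‖ ^ (p / 2)) (g := fun x => ‖f x‖ ^ (s / 2))
    (Eventually.of_forall fun _ => by positivity) (Eventually.of_forall fun _ => by positivity)
    ((hc _ (by positivity)).memLp_box _) ((hc _ (by positivity)).memLp_box _)
  have e : ∀ x, ‖f x‖ ^ (p / 2) * ‖f x‖ ^ (s / 2) = ‖f x‖ ^ ((p + s) / 2) := fun x => by
    rw [← Real.rpow_add_of_nonneg (norm_nonneg _) (by positivity) (by positivity)]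
    congr 1; ring
  have e2 : ∀ (t : ℝ) x, (‖f x‖ ^ (t / 2)) ^ (2 : ℝ) = ‖f x‖ ^ t := fun t x => by
    rw [← Real.rpow_mul (norm_nonneg _)]
    congr 1; ring
  simp_rw [e, e2] at this
  refine this.trans (le_of_eq ?_)
  have e3 : ∀ t : ℝ, 0 < t → (∫ x in unitBox n, ‖f x‖ ^ t) ^ (1 / 2 : ℝ) =
      boxNorm t f ^ (t / 2) := fun t ht => by
    rw [← boxNorm_rpow ht, ← Real.rpow_mul (boxNorm_nonneg _)]
    congr 1; ring
  rw [e3 p hp, e3 s hs]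

end boxNorm

/-! ### Periodic functions and characters -/

section Periodic

variable {n : ℕ} {E : Type*}

/-- A periodic function factors through the torus. -/
lemma PeriodicZ.exists_lift {f : Dom n → E} (hf : PeriodicZ f) :
    ∃ F : UnitAddTorus (Fin n) → E, ∀ x : Dom n, F (fun i => (x i : UnitAddCircle)) = f x := by
  refine ⟨fun y => f fun i => (y i).out, fun x => ?_⟩
  have h : ∀ i, ∃ m : ℤ, (Quotient.out (x i : UnitAddCircle) : ℝ) = x i + m := fun i => by
    have h1 : ((Quotient.out (x i : UnitAddCircle) : ℝ) : UnitAddCircle) = (x i : UnitAddCircle) :=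
      Quotient.out_eq' _
    rw [eq_comm, QuotientAddGroup.eq] at h1
    obtain ⟨m, hm⟩ := AddSubgroup.mem_zmultiples_iff.1 h1
    refine ⟨m, ?_⟩
    simp at hm
    linarith
  choose m hm using h
  rw [← hf x m]
  exact congrArg f (funext hm)

lemma isOpenQuotientMap_torus (n : ℕ) :
    IsOpenQuotientMap (fun (x : Dom n) (i : Fin n) => (x i : UnitAddCircle)) :=
  IsOpenQuotientMap.piMap fun _ => QuotientAddGroup.isOpenQuotientMap_mk

lemma PeriodicZ.exists_continuous_lift [TopologicalSpace E] {f : Dom n → E} (hf : PeriodicZ f)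
    (hc : Continuous f) :
    ∃ F : C(UnitAddTorus (Fin n), E), ∀ x : Dom n, F (fun i => (x i : UnitAddCircle)) = f x := by
  obtain ⟨F, hF⟩ := hf.exists_lift
  refine ⟨⟨F, (isOpenQuotientMap_torus n).isQuotientMap.continuous_iff.2 ?_⟩, hF⟩
  convert hc using 1
  ext x
  exact hF x

lemma setIntegral_unitBox_eq_Ioc [NormedAddCommGroup E] [NormedSpace ℝ E] (f : Dom n → E) :
    ∫ x in unitBox n, f x = ∫ x in {x : Dom n | ∀ i, x i ∈ Set.Ioc ((0 : Dom n) i)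
      ((0 : Dom n) i + 1)}, f x := by
  refine setIntegral_congr_set ?_
  have h1 : unitBox n =ᵐ[volume] Set.Icc (0 : Dom n) 1 := by
    exact Measure.univ_pi_Ico_ae_eq_Icc (μ := fun _ : Fin n => (volume : Measure ℝ))
      (f := (0 : Dom n)) (g := 1)
  have h2 : {x : Dom n | ∀ i, x i ∈ Set.Ioc ((0 : Dom n) i) ((0 : Dom n) i + 1)} =ᵐ[volume]
      Set.Icc (0 : Dom n) 1 := by
    have e : {x : Dom n | ∀ i, x i ∈ Set.Ioc ((0 : Dom n) i) ((0 : Dom n) i + 1)} =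
        Set.univ.pi fun i => Set.Ioc ((0 : Dom n) i) ((1 : Dom n) i) := by
      ext x
      simp [Set.mem_pi]
    rw [e]
    exact Measure.univ_pi_Ioc_ae_eq_Icc (μ := fun _ : Fin n => (volume : Measure ℝ))
      (f := (0 : Dom n)) (g := 1)
  exact h1.trans h2.symm

/-- Integrals of periodic functions over the unit box are translation invariant. -/
lemma PeriodicZ.integral_translate [NormedAddCommGroup E] [NormedSpace ℝ E] {f : Dom n → E}
    (hf : PeriodicZ f) (a : Dom n) :
    ∫ x in unitBox n, f (x + a) = ∫ x in unitBox n, f x := by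
  obtain ⟨F, hF⟩ := hf.exists_lift
  have h := (UnitAddTorus.integral_preimage F a).symm.trans (UnitAddTorus.integral_preimage F 0)
  simp only [hF] at h
  rw [setIntegral_unitBox_eq_Ioc f, ← h, setIntegral_unitBox_eq_Ioc]
  have hmp : MeasurePreserving (fun x : Dom n => x + a) volume volume :=
    measurePreserving_add_right volume a
  have := hmp.setIntegral_preimage_emb (Homeomorph.addRight a).measurableEmbedding f
    {x : Dom n | ∀ i, x i ∈ Set.Ioc (a i) (a i + 1)}
  rw [← this]
  congr 2
  ext x
  simp [add_comm (a _) 1]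

end Periodic

/-- The character `x ↦ exp (2πi k·x)`. -/
def boxChar {n : ℕ} (k : Fin n → ℤ) (x : Dom n) : ℂ :=
  Complex.exp (2 * Real.pi * I * ∑ i, (k i : ℂ) * (x i : ℂ))

section boxChar

variable {n : ℕ}

lemma boxChar_zero (x : Dom n) : boxChar 0 x = 1 := by simp [boxChar]

lemma boxChar_add (k l : Fin n → ℤ) (x : Dom n) :
    boxChar (k + l) x = boxChar k x * boxChar l x := by
  rw [boxChar, boxChar, boxChar, ← Complex.exp_add]
  congr 1
  simp [add_mul, Finset.sum_add_distrib, mul_add]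

lemma boxChar_add_right (k : Fin n → ℤ) (x y : Dom n) :
    boxChar k (x + y) = boxChar k x * boxChar k y := by
  rw [boxChar, boxChar, boxChar, ← Complex.exp_add]
  congr 1
  simp [mul_add, Finset.sum_add_distrib]

lemma boxChar_neg (k : Fin n → ℤ) (x : Dom n) :
    boxChar (-k) x = (starRingEnd ℂ) (boxChar k x) := by
  rw [boxChar, boxChar, ← Complex.exp_conj]
  congr 1
  simp [Complex.conj_ofNat]

lemma norm_boxChar (k : Fin n → ℤ) (x : Dom n) : ‖boxChar k x‖ = 1 := by
  rw [boxChar, Complex.norm_exp]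
  simp [← Complex.ofReal_intCast, ← Complex.ofReal_mul, ← Complex.ofReal_sum]

lemma contDiff_boxChar (k : Fin n → ℤ) : ContDiff ℝ (⊤ : ℕ∞) (boxChar k : Dom n → ℂ) := by
  unfold boxChar
  have : ∀ i : Fin n, ContDiff ℝ (⊤ : ℕ∞) (fun x : Dom n => (x i : ℂ)) := fun i =>
    Complex.ofRealCLM.contDiff.comp (contDiff_apply ℝ ℝ i)
  fun_prop

@[fun_prop]
lemma continuous_boxChar (k : Fin n → ℤ) : Continuous (boxChar k : Dom n → ℂ) :=
  (contDiff_boxChar k).continuous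

lemma boxChar_eq_mFourier (k : Fin n → ℤ) (x : Dom n) :
    UnitAddTorus.mFourier k (fun i => (x i : UnitAddCircle)) = boxChar k x := by
  simp only [UnitAddTorus.mFourier, ContinuousMap.coe_mk, fourier_coe_apply, boxChar]
  rw [← Complex.exp_sum, Finset.mul_sum]
  congr 1
  refine Finset.sum_congr rfl fun i _ => ?_
  simp
  ring

lemma periodicZ_boxChar (k : Fin n → ℤ) : PeriodicZ (boxChar k : Dom n → ℂ) := by
  intro x m
  rw [← boxChar_eq_mFourier, ← boxChar_eq_mFourier]
  congr 1
  ext i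
  simp

lemma integral_boxChar_of_ne_zero {k : Fin n → ℤ} (hk : k ≠ 0) :
    ∫ x in unitBox n, boxChar k x = 0 := by
  obtain ⟨j, hj⟩ := Function.ne_iff.1 hk
  have hj' : (k j : ℂ) ≠ 0 := by simpa using hj
  have h := (periodicZ_boxChar k).integral_translate (Pi.single j (1 / (2 * (k j : ℝ))))
  simp_rw [boxChar_add_right, integral_mul_const] at h
  have h1 : boxChar k (Pi.single j (1 / (2 * (k j : ℝ)))) = -1 := by
    rw [boxChar, ← Complex.exp_pi_mul_I, Finset.sum_eq_single j]
    · congr 1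
      simp
      field_simp
    · intro i _ hi
      simp [hi]
    · simp
  rw [h1] at h
  linear_combination (-1 / 2 : ℂ) * h

/-- Trigonometric polynomials are uniformly dense in the continuous periodic functions. -/
lemma exists_trigPoly_approx {f : Dom n → ℂ} (hf : Continuous f) (hp : PeriodicZ f) {ε : ℝ}
    (hε : 0 < ε) : ∃ (S : Finset (Fin n → ℤ)) (c : (Fin n → ℤ) → ℂ),
      ∀ x, ‖f x - ∑ k ∈ S, c k * boxChar k x‖ ≤ ε := by
  obtain ⟨F, hF⟩ := hp.exists_continuous_lift hf
  have hmem : F ∈ (Submodule.span ℂ (Set.range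
      (UnitAddTorus.mFourier (d := Fin n)))).topologicalClosure := by
    rw [UnitAddTorus.span_mFourier_closure_eq_top]; trivial
  obtain ⟨G, hG, hFG⟩ := Metric.mem_closure_iff.1 hmem ε hε
  obtain ⟨c, hc⟩ := (Finsupp.mem_span_range_iff_exists_finsupp).1 hG
  refine ⟨c.support, c, fun x => ?_⟩
  rw [dist_eq_norm] at hFG
  have := ((F - G).norm_coe_le_norm fun i => (x i : UnitAddCircle)).trans hFG.le
  refine le_of_eq_of_le ?_ this
  rw [ContinuousMap.sub_apply, hF, ← hc, Finsupp.sum]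
  simp [boxChar_eq_mFourier]

end boxChar

/-! ### Derivatives of periodic functions and Fourier coefficients -/

section Derivatives

variable {n : ℕ}

lemma fderiv_boxChar (k : Fin n → ℤ) (x v : Dom n) :
    fderiv ℝ (boxChar k) x v = 2 * Real.pi * I * (∑ i, (k i : ℂ) * (v i : ℂ)) * boxChar k x := by
  let Λ : Dom n →L[ℝ] ℂ := ∑ i, (2 * Real.pi * I * (k i : ℂ)) •
    (Complex.ofRealCLM.comp (ContinuousLinearMap.proj i : Dom n →L[ℝ] ℝ))
  have hΛ : ∀ y, Λ y = 2 * Real.pi * I * ∑ i, (k i : ℂ) * (y i : ℂ) := fun y => by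
    simp [Λ, sum_apply, Finset.mul_sum, mul_assoc]
  have h1 : (boxChar k : Dom n → ℂ) = fun y => Complex.exp (Λ y) := by
    ext y
    rw [hΛ, boxChar]
  have h2 := (Λ.hasFDerivAt (x := x)).cexp
  rw [h1, h2.fderiv]
  simp only [smul_apply, smul_eq_mul, hΛ]
  ring

lemma PeriodicZ.fderiv_apply {E : Type*} [NormedAddCommGroup E] [NormedSpace ℝ E]
    {f : Dom n → E} (hf : PeriodicZ f) (v : Dom n) :
    PeriodicZ fun x => fderiv ℝ f x v := by
  intro x m
  have : (fun y => f (y + fun i => (m i : ℝ))) = f := funext fun y => hf y m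
  simp only
  rw [← fderiv_comp_add_right, this]

lemma PeriodicZ.exists_bound {E : Type*} [NormedAddCommGroup E] {f : Dom n → E}
    (hf : PeriodicZ f) (hc : Continuous f) : ∃ C, 0 ≤ C ∧ ∀ x, ‖f x‖ ≤ C := by
  obtain ⟨F, hF⟩ := hf.exists_continuous_lift hc
  exact ⟨‖F‖, norm_nonneg _, fun x => hF x ▸ F.norm_coe_le_norm _⟩

/-- Directional derivatives of periodic functions have mean zero. -/
lemma PeriodicZ.integral_fderiv_eq_zero {f : Dom n → ℂ} (hf : PeriodicZ f)
    (hs : ContDiff ℝ 1 f) (v : Dom n) : ∫ x in unitBox n, fderiv ℝ f x v = 0 := by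
  have hc' : Continuous fun x => fderiv ℝ f x v :=
    (hs.continuous_fderiv one_ne_zero).clm_apply continuous_const
  obtain ⟨C, -, hC⟩ := (hf.fderiv_apply v).exists_bound hc'
  have key := hasDerivAt_integral_of_dominated_loc_of_deriv_le (μ := boxVol n) (𝕜 := ℝ)
    (F := fun (t : ℝ) x => f (x + t • v)) (F' := fun t x => fderiv ℝ f (x + t • v) v)
    (x₀ := 0) (bound := fun _ => C) (s := Set.univ) univ_mem
    (Eventually.of_forall fun t => (hs.continuous.comp
      (continuous_id.add continuous_const)).integrable_box.aestronglyMeasurable)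
    (hs.continuous.comp (continuous_id.add continuous_const)).integrable_box
    (hc'.comp (continuous_id.add continuous_const)).integrable_box.aestronglyMeasurable
    (Eventually.of_forall fun x t _ => hC _) (integrable_const C)
    (Eventually.of_forall fun x t _ => by
      have h1 : HasDerivAt (fun t : ℝ => x + t • v) v t := by
        simpa using ((hasDerivAt_id t).smul_const v).const_add x
      exact ((hs.differentiable one_ne_zero _).hasFDerivAt).comp_hasDerivAt t h1)
  have h2 : (fun t : ℝ => ∫ x in unitBox n, f (x + t • v)) =
      fun _ => ∫ x in unitBox n, f x := funext fun t => hf.integral_translate _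
  have h3 := key.2
  rw [h2] at h3
  have := h3.unique (hasDerivAt_const _ _)
  simpa using this

lemma integral_boxChar_mul_fderiv {f : Dom n → ℂ} (hf : PeriodicZ f) (hs : ContDiff ℝ 1 f)
    (k : Fin n → ℤ) (v : Dom n) :
    ∫ x in unitBox n, boxChar (-k) x * fderiv ℝ f x v =
      2 * Real.pi * I * (∑ i, (k i : ℂ) * (v i : ℂ)) *
        ∫ x in unitBox n, boxChar (-k) x * f x := by
  have hp : PeriodicZ fun x => boxChar (-k) x * f x := fun x m => by
    simp only
    rw [periodicZ_boxChar, hf]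
  have hb : ContDiff ℝ 1 (boxChar (-k) : Dom n → ℂ) := (contDiff_boxChar _).of_le (by norm_cast)
  have h := hp.integral_fderiv_eq_zero (hb.mul hs) v
  have e : ∀ x, fderiv ℝ (fun x => boxChar (-k) x * f x) x v = boxChar (-k) x * fderiv ℝ f x v -
      2 * Real.pi * I * (∑ i, (k i : ℂ) * (v i : ℂ)) * (boxChar (-k) x * f x) := fun x => by
    rw [fderiv_fun_mul (hb.differentiable one_ne_zero x) (hs.differentiable one_ne_zero x)]
    simp only [add_apply, smul_apply, smul_eq_mul]
    rw [fderiv_boxChar]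
    simp
    ring
  have hc' : Continuous fun x => fderiv ℝ f x v :=
    (hs.continuous_fderiv one_ne_zero).clm_apply continuous_const
  simp_rw [e] at h
  rw [integral_sub, integral_const_mul] at h
  · exact sub_eq_zero.1 h
  · exact ((continuous_boxChar _).mul hc').integrable_box
  · exact (((continuous_boxChar _).mul hs.continuous).integrable_box).const_mul _

lemma contDiff_iteratedFDeriv_apply {E : Type*} [NormedAddCommGroup E] [NormedSpace ℝ E]
    {f : Dom n → E} (hs : ContDiff ℝ (⊤ : ℕ∞) f) (K : ℕ) (v : Fin K → Dom n) :
    ContDiff ℝ (⊤ : ℕ∞) fun x => iteratedFDeriv ℝ K f x v := by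
  have h1 : ContDiff ℝ (⊤ : ℕ∞) (iteratedFDeriv ℝ K f) :=
    hs.iteratedFDeriv_right (by norm_cast)
  exact (ContinuousMultilinearMap.apply ℝ (fun _ : Fin K => Dom n) E v).contDiff.comp h1

lemma iteratedFDeriv_succ_apply_eq_fderiv {E : Type*} [NormedAddCommGroup E] [NormedSpace ℝ E]
    {f : Dom n → E} (hs : ContDiff ℝ (⊤ : ℕ∞) f) (K : ℕ) (v : Fin (K + 1) → Dom n)
    (x : Dom n) : iteratedFDeriv ℝ (K + 1) f x v =
      fderiv ℝ (fun y => iteratedFDeriv ℝ K f y (Fin.tail v)) x (v 0) := by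
  refine DifferentiableAt.iteratedFDeriv_succ_apply_left' ?_
  exact hs.differentiable_iteratedFDeriv (by norm_cast; exact WithTop.coe_lt_top K) x

lemma PeriodicZ.iteratedFDeriv_apply {E : Type*} [NormedAddCommGroup E] [NormedSpace ℝ E]
    {f : Dom n → E} (hf : PeriodicZ f) (hs : ContDiff ℝ (⊤ : ℕ∞) f) :
    ∀ (K : ℕ) (v : Fin K → Dom n), PeriodicZ fun x => iteratedFDeriv ℝ K f x v
  | 0, v => fun x m => by simpa using hf x m
  | K + 1, v => by
    simp_rw [iteratedFDeriv_succ_apply_eq_fderiv hs]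
    exact (PeriodicZ.iteratedFDeriv_apply hf hs K _).fderiv_apply _

lemma integral_boxChar_mul_iteratedFDeriv {f : Dom n → ℂ} (hf : PeriodicZ f)
    (hs : ContDiff ℝ (⊤ : ℕ∞) f) (k : Fin n → ℤ) :
    ∀ (K : ℕ) (α : Fin K → Fin n),
      ∫ x in unitBox n, boxChar (-k) x * iteratedFDeriv ℝ K f x (fun i => Pi.single (α i) 1) =
        (2 * Real.pi * I) ^ K * (∏ i, (k (α i) : ℂ)) * ∫ x in unitBox n, boxChar (-k) x * f x
  | 0, α => by simp
  | K + 1, α => by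
    simp_rw [iteratedFDeriv_succ_apply_eq_fderiv hs]
    rw [integral_boxChar_mul_fderiv (hf.iteratedFDeriv_apply hs K _)
      ((contDiff_iteratedFDeriv_apply hs K _).of_le (by norm_cast))]
    have := integral_boxChar_mul_iteratedFDeriv hf hs k K (Fin.tail α)
    simp only [Fin.tail_def] at this ⊢
    rw [this, Finset.sum_eq_single (α 0), Fin.prod_univ_succ]
    · simp
      ring
    · intro i _ hi
      simp [hi]
    · simp

lemma contDiff_trigPoly (S : Finset (Fin n → ℤ)) (c : (Fin n → ℤ) → ℂ) :
    ContDiff ℝ (⊤ : ℕ∞) fun x : Dom n => ∑ k ∈ S, c k * boxChar k x :=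
  ContDiff.sum fun k _ => contDiff_const.mul (contDiff_boxChar k)

lemma fderiv_trigPoly (S : Finset (Fin n → ℤ)) (c : (Fin n → ℤ) → ℂ) (x v : Dom n) :
    fderiv ℝ (fun x => ∑ k ∈ S, c k * boxChar k x) x v =
      ∑ k ∈ S, c k * (2 * Real.pi * I * (∑ i, (k i : ℂ) * (v i : ℂ))) * boxChar k x := by
  have hd : ∀ k : Fin n → ℤ, DifferentiableAt ℝ (boxChar k) x := fun k =>
    (contDiff_boxChar k).differentiable (by simp) x
  rw [fderiv_fun_sum fun k _ => (hd k).const_mul (c k), sum_apply]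
  refine Finset.sum_congr rfl fun k _ => ?_
  rw [fderiv_const_mul (hd k), smul_apply, fderiv_boxChar, smul_eq_mul]
  ring

lemma iteratedFDeriv_trigPoly (S : Finset (Fin n → ℤ)) (c : (Fin n → ℤ) → ℂ) :
    ∀ (K : ℕ) (α : Fin K → Fin n) (x : Dom n),
      iteratedFDeriv ℝ K (fun x => ∑ k ∈ S, c k * boxChar k x) x
        (fun i => Pi.single (α i) 1) =
      ∑ k ∈ S, c k * ((2 * Real.pi * I) ^ K * ∏ i, (k (α i) : ℂ)) * boxChar k x
  | 0, α, x => by simp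
  | K + 1, α, x => by
    rw [iteratedFDeriv_succ_apply_eq_fderiv (contDiff_trigPoly S c)]
    have := iteratedFDeriv_trigPoly S c K (Fin.tail α)
    simp only [Fin.tail_def] at this ⊢
    simp_rw [this]
    rw [fderiv_trigPoly]
    refine Finset.sum_congr rfl fun k _ => ?_
    rw [Finset.sum_eq_single (α 0), Fin.prod_univ_succ]
    · simp only [Pi.single_eq_same, Complex.ofReal_one, mul_one]
      ring
    · intro i _ hi
      simp [hi]
    · simp

lemma continuous_trigPoly (S : Finset (Fin n → ℤ)) (c : (Fin n → ℤ) → ℂ) :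
    Continuous fun x : Dom n => ∑ k ∈ S, c k * boxChar k x :=
  (contDiff_trigPoly S c).continuous

lemma periodicZ_trigPoly (S : Finset (Fin n → ℤ)) (c : (Fin n → ℤ) → ℂ) :
    PeriodicZ fun x : Dom n => ∑ k ∈ S, c k * boxChar k x := fun x m => by
  simp only [periodicZ_boxChar _ x m]

lemma integral_trigPoly_of_notMem {S : Finset (Fin n → ℤ)} (hS : 0 ∉ S)
    (c : (Fin n → ℤ) → ℂ) : ∫ x in unitBox n, ∑ k ∈ S, c k * boxChar k x = 0 := by
  have hInt : ∀ k ∈ S, Integrable (fun x => c k * boxChar k x) (boxVol n) := fun k _ =>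
    (continuous_const.mul (continuous_boxChar k)).integrable_box
  rw [integral_finsetSum _ hInt]
  refine Finset.sum_eq_zero fun k hk => ?_
  rw [integral_const_mul, integral_boxChar_of_ne_zero (fun h => hS (h ▸ hk)), mul_zero]

end Derivatives

section Operator

variable {n d N K : ℕ}

/-- The matrix of the Fourier symbol. -/
def opMatrix (A : (Fin K → Fin n) → (Ed d →ₗ[ℝ] Ed N)) (ξ : Fin n → ℝ) :
    Matrix (Fin N) (Fin d) ℝ :=
  fun i j => ∑ α : Fin K → Fin n, (∏ l, ξ (α l)) * A α (EuclideanSpace.single j 1) i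

lemma linearMap_apply_eq_sum (T : Ed d →ₗ[ℝ] Ed N) (v : Ed d) (i : Fin N) :
    T v i = ∑ j, T (EuclideanSpace.single j 1) i * v j := by
  have hv : v = ∑ j, v j • EuclideanSpace.single j (1 : ℝ) := by
    ext i
    simp [Finset.sum_apply, Pi.single_apply]
  conv_lhs => rw [hv]
  simp [Finset.sum_apply, mul_comm]

lemma opApply_apply (A : (Fin K → Fin n) → (Ed d →ₗ[ℝ] Ed N)) (u : Dom n → Ed d) (x : Dom n)
    (i : Fin N) : opApply A u x i = ∑ α : Fin K → Fin n, ∑ j,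
      A α (EuclideanSpace.single j 1) i *
        iteratedFDeriv ℝ K u x (fun l => Pi.single (α l) 1) j := by
  rw [opApply]
  simp only [WithLp.ofLp_sum, Finset.sum_apply]
  exact Finset.sum_congr rfl fun α _ => linearMap_apply_eq_sum _ _ _

lemma iteratedFDeriv_coord {u : Dom n → Ed d} (hu : ContDiff ℝ (⊤ : ℕ∞) u) (j : Fin d)
    (x : Dom n) (v : Fin K → Dom n) :
    iteratedFDeriv ℝ K (fun y => u y j) x v = iteratedFDeriv ℝ K u x v j := by
  have := (EuclideanSpace.proj (𝕜 := ℝ) j : Ed d →L[ℝ] ℝ).iteratedFDeriv_comp_left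
    (i := K) (x := x) (hu.contDiffAt (x := x)) (by norm_cast; exact le_top)
  have h2 := congrArg (fun T => T v) this
  simpa [Function.comp_def] using h2

lemma iteratedFDeriv_ofReal {f : Dom n → ℝ} (hu : ContDiff ℝ (⊤ : ℕ∞) f)
    (x : Dom n) (v : Fin K → Dom n) :
    iteratedFDeriv ℝ K (fun y => (f y : ℂ)) x v = (iteratedFDeriv ℝ K f x v : ℂ) := by
  have := Complex.ofRealCLM.iteratedFDeriv_comp_left
    (i := K) (x := x) (hu.contDiffAt (x := x)) (by norm_cast; exact le_top)
  have h2 := congrArg (fun T => T v) this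
  simpa [Function.comp_def] using h2

lemma iteratedFDeriv_re {f : Dom n → ℂ} (hu : ContDiff ℝ (⊤ : ℕ∞) f)
    (x : Dom n) (v : Fin K → Dom n) :
    iteratedFDeriv ℝ K (fun y => (f y).re) x v = (iteratedFDeriv ℝ K f x v).re := by
  have := Complex.reCLM.iteratedFDeriv_comp_left
    (i := K) (x := x) (hu.contDiffAt (x := x)) (by norm_cast; exact le_top)
  have h2 := congrArg (fun T => T v) this
  simpa [Function.comp_def] using h2

lemma contDiff_coord {u : Dom n → Ed d} (hu : ContDiff ℝ (⊤ : ℕ∞) u) (j : Fin d) :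
    ContDiff ℝ (⊤ : ℕ∞) fun y => u y j :=
  (EuclideanSpace.proj (𝕜 := ℝ) j : Ed d →L[ℝ] ℝ).contDiff.comp hu

/-- The Fourier coefficients of `𝒜`-free maps lie in the kernel of the symbol. -/
lemma opMatrix_mul_fourierCoeff_eq_zero {A : (Fin K → Fin n) → (Ed d →ₗ[ℝ] Ed N)}
    {φ : Dom n → Ed d} (hφ : φ ∈ opTestClass A) (k : Fin n → ℤ) (i : Fin N) :
    ∑ j, (opMatrix A (fun l => (k l : ℝ)) i j : ℂ) *
      ∫ x in unitBox n, boxChar (-k) x * (φ x j : ℂ) = 0 := by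
  obtain ⟨hs, hp, h0, -⟩ := hφ
  have hsj : ∀ j, ContDiff ℝ (⊤ : ℕ∞) fun y => (φ y j : ℂ) := fun j =>
    Complex.ofRealCLM.contDiff.comp (contDiff_coord hs j)
  have hpj : ∀ j, PeriodicZ fun y => (φ y j : ℂ) := fun j x m => by simp only [hp x m]
  have h1 : ∀ x, boxChar (-k) x * (opApply A φ x i : ℂ) = ∑ α : Fin K → Fin n, ∑ j,
      (A α (EuclideanSpace.single j 1) i : ℂ) * (boxChar (-k) x *
        iteratedFDeriv ℝ K (fun y => (φ y j : ℂ)) x (fun l => Pi.single (α l) 1)) := fun x => by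
    rw [opApply_apply]
    push_cast
    rw [Finset.mul_sum]
    refine Finset.sum_congr rfl fun α _ => ?_
    rw [Finset.mul_sum]
    refine Finset.sum_congr rfl fun j _ => ?_
    rw [iteratedFDeriv_ofReal (contDiff_coord hs j), iteratedFDeriv_coord hs]
    ring
  have h2 : ∫ x in unitBox n, boxChar (-k) x * (opApply A φ x i : ℂ) = 0 := by
    simp [h0]
  have hInt : ∀ (α : Fin K → Fin n) (j : Fin d), Integrable (fun x =>
      (A α (EuclideanSpace.single j 1) i : ℂ) * (boxChar (-k) x *
        iteratedFDeriv ℝ K (fun y => (φ y j : ℂ)) x (fun l => Pi.single (α l) 1))) (boxVol n) :=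
    fun α j => (continuous_const.mul ((continuous_boxChar _).mul
      (contDiff_iteratedFDeriv_apply (hsj j) K _).continuous)).integrable_box
  simp_rw [h1] at h2
  rw [integral_finsetSum _ fun α _ => integrable_finsetSum _ fun j _ => hInt α j] at h2
  simp_rw [integral_finsetSum Finset.univ fun j _ => hInt _ j, integral_const_mul,
    integral_boxChar_mul_iteratedFDeriv (hpj _) (hsj _)] at h2
  have hne : (2 * Real.pi * I : ℂ) ^ K ≠ 0 := pow_ne_zero _ Complex.two_pi_I_ne_zero
  refine (mul_eq_zero.1 ?_).resolve_left hne
  rw [← h2, Finset.sum_comm, Finset.mul_sum]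
  refine Finset.sum_congr rfl fun j _ => ?_
  simp only [opMatrix]
  push_cast
  rw [Finset.sum_mul, Finset.mul_sum]
  refine Finset.sum_congr rfl fun α _ => ?_
  ring

/-- Trigonometric polynomials with coefficients in the kernel of the symbol are `𝒜`-free. -/
lemma trigPoly_mem_opTestClass {A : (Fin K → Fin n) → (Ed d →ₗ[ℝ] Ed N)}
    {S : Finset (Fin n → ℤ)} (hS : 0 ∉ S) (c : Fin d → (Fin n → ℤ) → ℂ)
    (hc : ∀ k ∈ S, ∀ i, ∑ j, (opMatrix A (fun l => (k l : ℝ)) i j : ℂ) * c j k = 0) :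
    (fun x => WithLp.toLp 2 fun j => (∑ k ∈ S, c j k * boxChar k x).re) ∈ opTestClass A := by
  have hre : ∀ j, ContDiff ℝ (⊤ : ℕ∞) fun x : Dom n => (∑ k ∈ S, c j k * boxChar k x).re :=
    fun j => Complex.reCLM.contDiff.comp (contDiff_trigPoly S (c j))
  have hs : ContDiff ℝ (⊤ : ℕ∞) (fun x : Dom n => (WithLp.toLp 2 fun j =>
      (∑ k ∈ S, c j k * boxChar k x).re : Ed d)) := contDiff_euclidean.2 fun j => hre j
  refine ⟨hs, fun x m => ?_, fun x => ?_, ?_⟩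
  · simp only [periodicZ_boxChar _ x m]
  · ext i
    rw [opApply_apply]
    have h1 : ∀ (α : Fin K → Fin n) (j : Fin d), A α (EuclideanSpace.single j 1) i *
        iteratedFDeriv ℝ K (fun x : Dom n => (WithLp.toLp 2 fun j =>
          (∑ k ∈ S, c j k * boxChar k x).re : Ed d)) x (fun l => Pi.single (α l) 1) j =
        (∑ k ∈ S, (A α (EuclideanSpace.single j 1) i : ℂ) *
          (c j k * ((2 * Real.pi * I) ^ K * ∏ l, (k (α l) : ℂ)) * boxChar k x)).re :=
      fun α j => by
        rw [← iteratedFDeriv_coord hs, iteratedFDeriv_re (contDiff_trigPoly S (c j)),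
          iteratedFDeriv_trigPoly, ← Complex.re_ofReal_mul, Finset.mul_sum]
    simp_rw [h1, ← Complex.re_sum]
    have h2 : ∑ α : Fin K → Fin n, ∑ j, ∑ k ∈ S, (A α (EuclideanSpace.single j 1) i : ℂ) *
        (c j k * ((2 * Real.pi * I) ^ K * ∏ l, (k (α l) : ℂ)) * boxChar k x) = 
        ∑ k ∈ S, (2 * Real.pi * I) ^ K * boxChar k x *
          ∑ j, (opMatrix A (fun l => (k l : ℝ)) i j : ℂ) * c j k := by
      simp_rw [Finset.sum_comm (t := S)]
      refine Finset.sum_congr rfl fun k _ => ?_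
      rw [Finset.sum_comm, Finset.mul_sum]
      refine Finset.sum_congr rfl fun j _ => ?_
      simp only [opMatrix]
      push_cast
      rw [Finset.sum_mul, Finset.mul_sum]
      refine Finset.sum_congr rfl fun α _ => ?_
      ring
    rw [h2, Finset.sum_eq_zero fun k hk => by rw [hc k hk i, mul_zero]]
    simp
  · ext j
    have h1 := (EuclideanSpace.proj (𝕜 := ℝ) j : Ed d →L[ℝ] ℝ).integral_comp_comm
      (hs.continuous.integrable_box)
    have h2 := Complex.reCLM.integral_comp_comm
      ((continuous_trigPoly S (c j)).integrable_box (n := n))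
    rw [integral_trigPoly_of_notMem hS] at h2
    refine h1.symm.trans ?_
    simp only [Complex.reCLM_apply, Complex.zero_re] at h2
    exact h2

end Operator

/-! ### Fourier multipliers -/

/-- `μ` is a Fourier multiplier on trigonometric polynomials, with `L^r` norm at most `C`. -/
def IsMult {n : ℕ} (r : ℝ) (μ : (Fin n → ℤ) → ℝ) (C : ℝ) : Prop :=
  ∀ (S : Finset (Fin n → ℤ)) (c : (Fin n → ℤ) → ℂ),
    boxNorm r (fun x : Dom n => ∑ k ∈ S, (μ k * c k) * boxChar k x) ≤
      C * boxNorm r (fun x : Dom n => ∑ k ∈ S, c k * boxChar k x)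

section IsMult

variable {n : ℕ} {r : ℝ} {μ ν : (Fin n → ℤ) → ℝ} {C D : ℝ}

lemma IsMult.mono (h : IsMult r μ C) (hCD : C ≤ D) : IsMult r μ D := fun S c =>
  (h S c).trans (mul_le_mul_of_nonneg_right hCD (boxNorm_nonneg _))

lemma boxNorm_boxChar (hr : 0 < r) (k : Fin n → ℤ) : boxNorm r (boxChar k : Dom n → ℂ) = 1 := by
  rw [← boxNorm_norm]
  simp_rw [norm_boxChar]
  rw [boxNorm_const hr, norm_one]

lemma IsMult.abs_le (hr : 0 < r) (h : IsMult r μ C) (k : Fin n → ℤ) : |μ k| ≤ C := by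
  have := h {k} 1
  simp only [Finset.sum_singleton, Pi.one_apply, mul_one, one_mul] at this
  rw [boxNorm_const_mul hr, boxNorm_boxChar hr] at this
  simpa using this

lemma IsMult.nonneg (hr : 0 < r) (h : IsMult r μ C) : 0 ≤ C :=
  (abs_nonneg _).trans (h.abs_le hr 0)

lemma isMult_const (hr : 0 < r) (a : ℝ) : IsMult r (fun _ : Fin n → ℤ => a) |a| := fun S c => by
  simp_rw [mul_assoc, ← Finset.mul_sum]
  rw [boxNorm_const_mul hr]
  simp

lemma IsMult.add (hr : 1 ≤ r) (h : IsMult r μ C) (h' : IsMult r ν D) :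
    IsMult r (fun k => μ k + ν k) (C + D) := fun S c => by
  have e : ∀ x : Dom n, ∑ k ∈ S, (((μ k + ν k : ℝ) : ℂ) * c k) * boxChar k x =
      (∑ k ∈ S, (μ k * c k) * boxChar k x) + ∑ k ∈ S, (ν k * c k) * boxChar k x := fun x => by
    rw [← Finset.sum_add_distrib]
    exact Finset.sum_congr rfl fun k _ => by push_cast; ring
  simp_rw [e]
  refine (boxNorm_add_le hr (continuous_trigPoly S _) (continuous_trigPoly S _)).trans ?_
  rw [add_mul]
  exact add_le_add (h S c) (h' S c)

lemma IsMult.mul (hr : 0 < r) (h : IsMult r μ C) (h' : IsMult r ν D) :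
    IsMult r (fun k => μ k * ν k) (C * D) := fun S c => by
  have e : ∀ x : Dom n, ∑ k ∈ S, (((μ k * ν k : ℝ) : ℂ) * c k) * boxChar k x =
      ∑ k ∈ S, (μ k * (ν k * c k)) * boxChar k x := fun x =>
    Finset.sum_congr rfl fun k _ => by push_cast; ring
  simp_rw [e]
  refine (h S _).trans ?_
  rw [mul_assoc]
  exact mul_le_mul_of_nonneg_left (h' S c) (h.nonneg hr)

lemma IsMult.const_mul (hr : 0 < r) (h : IsMult r μ C) (a : ℝ) :
    IsMult r (fun k => a * μ k) (|a| * C) := (isMult_const hr a).mul hr h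

lemma IsMult.neg (hr : 0 < r) (h : IsMult r μ C) : IsMult r (fun k => -μ k) C := by
  simpa using h.const_mul hr (-1)

lemma IsMult.sub (hr : 1 ≤ r) (h : IsMult r μ C) (h' : IsMult r ν D) :
    IsMult r (fun k => μ k - ν k) (C + D) := by
  simpa [sub_eq_add_neg] using h.add hr (h'.neg (by linarith))

lemma IsMult.sum (hr : 1 ≤ r) {ι : Type*} (s : Finset ι) {μ : ι → (Fin n → ℤ) → ℝ} {C : ι → ℝ}
    (h : ∀ i ∈ s, IsMult r (μ i) (C i)) : IsMult r (fun k => ∑ i ∈ s, μ i k) (∑ i ∈ s, C i) := by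
  classical
  induction s using Finset.induction_on with
  | empty => simpa using isMult_const (n := n) (by linarith) 0
  | insert a s ha ih =>
    simp only [Finset.sum_insert ha]
    exact (h a (by simp)).add hr (ih fun i hi => h i (by simp [hi]))

lemma IsMult.prod (hr : 0 < r) {ι : Type*} (s : Finset ι) {μ : ι → (Fin n → ℤ) → ℝ} {C : ι → ℝ}
    (h : ∀ i ∈ s, IsMult r (μ i) (C i)) : IsMult r (fun k => ∏ i ∈ s, μ i k) (∏ i ∈ s, C i) := by
  classical
  induction s using Finset.induction_on with
  | empty => simpa using isMult_const (n := n) hr 1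
  | insert a s ha ih =>
    simp only [Finset.prod_insert ha]
    exact (h a (by simp)).mul hr (ih fun i hi => h i (by simp [hi]))

lemma boxNorm_trigPoly_le (hr : 0 < r) (S : Finset (Fin n → ℤ)) (c : (Fin n → ℤ) → ℂ) :
    boxNorm r (fun x : Dom n => ∑ k ∈ S, c k * boxChar k x) ≤ ∑ k ∈ S, ‖c k‖ :=
  boxNorm_le_of_bound hr (continuous_trigPoly S c) (Finset.sum_nonneg fun _ _ => norm_nonneg _)
    fun x => (norm_sum_le _ _).trans_eq (by simp [norm_boxChar])

/-- Multipliers are closed under pointwise limits with bounded norms. -/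
lemma IsMult.of_tendsto (hr : 1 ≤ r) {μ : ℕ → (Fin n → ℤ) → ℝ} {D : ℕ → ℝ}
    (h : ∀ l, IsMult r (μ l) (D l)) (hD : Tendsto D atTop (𝓝 C))
    (hν : ∀ k, Tendsto (fun l => μ l k) atTop (𝓝 (ν k))) : IsMult r ν C := fun S c => by
  have hr0 : 0 < r := by linarith
  have h1 : ∀ l, boxNorm r (fun x : Dom n => ∑ k ∈ S, (ν k * c k) * boxChar k x) ≤
      D l * boxNorm r (fun x : Dom n => ∑ k ∈ S, c k * boxChar k x) +
        ∑ k ∈ S, ‖((ν k - μ l k : ℝ) : ℂ) * c k‖ := fun l => by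
    refine le_trans ?_ (add_le_add (h l S c) (boxNorm_trigPoly_le hr0 S _))
    refine le_trans (le_of_eq ?_) (boxNorm_add_le hr (continuous_trigPoly S _)
      (continuous_trigPoly S _))
    congr 1
    ext x
    rw [← Finset.sum_add_distrib]
    exact Finset.sum_congr rfl fun k _ => by push_cast; ring
  have h2 : Tendsto (fun l => D l * boxNorm r (fun x : Dom n => ∑ k ∈ S, c k * boxChar k x) +
        ∑ k ∈ S, ‖((ν k - μ l k : ℝ) : ℂ) * c k‖) atTop
      (𝓝 (C * boxNorm r (fun x : Dom n => ∑ k ∈ S, c k * boxChar k x) +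
        ∑ k ∈ S, ‖((ν k - ν k : ℝ) : ℂ) * c k‖)) := by
    refine (hD.mul_const _).add (tendsto_finsetSum _ fun k _ => ?_)
    have h3 : Tendsto (fun l => ν k - μ l k) atTop (𝓝 (ν k - ν k)) :=
      tendsto_const_nhds.sub (hν k)
    exact (((Complex.continuous_ofReal.tendsto _).comp h3).mul_const _).norm
  simpa using ge_of_tendsto' h2 h1

end IsMult

/-! ### The M. Riesz theorem for half-spaces -/

lemma exists_norm_pow_le (m : ℕ) (hm : m ≠ 0) : ∃ C : ℝ, 0 ≤ C ∧ ∀ z : ℂ,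
    ‖z‖ ^ (2 * m) ≤ C * |z.re| ^ (2 * m) + 2 * (-1) ^ m * (z ^ (2 * m)).re := by
  set g : ℂ → ℝ := fun z => 1 - 2 * (-1) ^ m * (z ^ (2 * m)).re with hg
  have hgc : Continuous g := by fun_prop
  have hE : IsCompact (Metric.sphere (0 : ℂ) 1 ∩ {z | 0 ≤ g z}) :=
    (isCompact_sphere _ _).inter_right (isClosed_le continuous_const hgc)
  obtain ⟨δ, hδ, hmin⟩ := hE.exists_forall_le' (f := fun z : ℂ => |z.re| ^ (2 * m)) (a := 0)
    (by fun_prop) (by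
      rintro z ⟨hz, hz'⟩
      have hre : z.re ≠ 0 := by
        intro h0
        have hzz : z = z.im * I := by
          apply Complex.ext <;> simp [h0]
        have him : z.im ^ 2 = 1 := by
          have : ‖z‖ ^ 2 = 1 := by rw [mem_sphere_zero_iff_norm.1 hz, one_pow]
          rw [Complex.sq_norm, Complex.normSq_apply, h0] at this
          linarith
        have : z ^ (2 * m) = (((-1 : ℝ) ^ m : ℝ) : ℂ) := by
          rw [pow_mul, hzz, mul_pow, I_sq, ← Complex.ofReal_pow, him]
          simp
        simp only [hg, Set.mem_ofPred_eq, this, Complex.ofReal_re] at hz'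
        have h1 : ((-1 : ℝ) ^ m) * (-1) ^ m = 1 := by rw [← mul_pow]; simp
        nlinarith
      positivity)
  have hunit : ∀ w : ℂ, ‖w‖ = 1 → 1 ≤ 3 / δ * |w.re| ^ (2 * m) +
      2 * (-1) ^ m * (w ^ (2 * m)).re := fun w hw => by
    by_cases h0 : 0 ≤ g w
    · have h1 := hmin w ⟨mem_sphere_zero_iff_norm.2 hw, h0⟩
      have h2 : |2 * (-1) ^ m * (w ^ (2 * m)).re| ≤ 2 := by
        rw [abs_mul, abs_mul, abs_pow, abs_neg, abs_one, one_pow, abs_two, mul_one]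
        have := (Complex.abs_re_le_norm (w ^ (2 * m)))
        rw [norm_pow, hw, one_pow] at this
        linarith
      have h3 : 3 ≤ 3 / δ * |w.re| ^ (2 * m) := by
        rw [div_mul_eq_mul_div, le_div_iff₀ hδ]
        linarith
      have := (abs_le.1 h2).1
      linarith
    · have h1 : 0 ≤ 3 / δ * |w.re| ^ (2 * m) := by positivity
      simp only [hg, not_le] at h0
      linarith
  refine ⟨3 / δ, by positivity, fun z => ?_⟩
  rcases eq_or_ne z 0 with rfl | hz
  · simp [hm]
  have hz' : 0 < ‖z‖ := norm_pos_iff.2 hz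
  set w : ℂ := ((‖z‖⁻¹ : ℝ) : ℂ) * z with hw
  have hzw : z = (‖z‖ : ℂ) * w := by
    rw [hw, ← mul_assoc, ← Complex.ofReal_mul, mul_inv_cancel₀ hz'.ne']
    simp
  have hw1 : ‖w‖ = 1 := by
    rw [hw, norm_mul, Complex.norm_real, Real.norm_of_nonneg (by positivity),
      inv_mul_cancel₀ hz'.ne']
  have e1 : |z.re| ^ (2 * m) = ‖z‖ ^ (2 * m) * |w.re| ^ (2 * m) := by
    conv_lhs => rw [hzw, Complex.re_ofReal_mul, abs_mul, abs_norm, mul_pow]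
  have e2 : (z ^ (2 * m)).re = ‖z‖ ^ (2 * m) * (w ^ (2 * m)).re := by
    conv_lhs => rw [hzw, mul_pow, ← Complex.ofReal_pow, Complex.re_ofReal_mul]
  rw [e1, e2]
  have := mul_le_mul_of_nonneg_left (hunit w hw1) (pow_nonneg hz'.le (2 * m))
  linarith

section Riesz

variable {n : ℕ} {H : Set (Fin n → ℤ)}

lemma continuous_of_mem_span {f : Dom n → ℂ} (hf : f ∈ Submodule.span ℂ (boxChar '' H)) :
    Continuous f := by
  induction hf using Submodule.span_induction with
  | mem x h => obtain ⟨k, -, rfl⟩ := h; exact continuous_boxChar k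
  | zero => exact continuous_const
  | add f g _ _ hf hg => exact hf.add hg
  | smul a f _ hf => exact continuous_const.mul hf

lemma integral_eq_zero_of_mem_span (h0 : 0 ∉ H) {f : Dom n → ℂ}
    (hf : f ∈ Submodule.span ℂ (boxChar '' H)) : ∫ x in unitBox n, f x = 0 := by
  induction hf using Submodule.span_induction with
  | mem x h =>
    obtain ⟨k, hk, rfl⟩ := h
    exact integral_boxChar_of_ne_zero fun h => h0 (h ▸ hk)
  | zero => simp
  | add f g hf' hg' hf hg =>
    simp only [Pi.add_apply]
    rw [integral_add (continuous_of_mem_span hf').integrable_box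
      (continuous_of_mem_span hg').integrable_box, hf, hg, add_zero]
  | smul a f _ hf =>
    simp only [Pi.smul_apply, smul_eq_mul]
    rw [integral_const_mul, hf, mul_zero]

lemma mul_mem_span (hadd : ∀ a ∈ H, ∀ b ∈ H, a + b ∈ H) {f g : Dom n → ℂ}
    (hf : f ∈ Submodule.span ℂ (boxChar '' H)) (hg : g ∈ Submodule.span ℂ (boxChar '' H)) :
    f * g ∈ Submodule.span ℂ (boxChar '' H) := by
  have h := Submodule.mul_mem_mul hf hg
  rw [Submodule.span_mul_span] at h
  refine Submodule.span_mono ?_ h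
  rintro _ ⟨_, ⟨a, ha, rfl⟩, _, ⟨b, hb, rfl⟩, rfl⟩
  exact ⟨a + b, hadd a ha b hb, funext fun x => boxChar_add a b x⟩

lemma pow_succ_mem_span (hadd : ∀ a ∈ H, ∀ b ∈ H, a + b ∈ H) {f : Dom n → ℂ}
    (hf : f ∈ Submodule.span ℂ (boxChar '' H)) (l : ℕ) :
    f ^ (l + 1) ∈ Submodule.span ℂ (boxChar '' H) := by
  induction l with
  | zero => simpa using hf
  | succ l ih => rw [pow_succ]; exact mul_mem_span hadd ih hf

/-- An analytic function is controlled by its real part. -/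
lemma exists_boxNorm_le_re (m : ℕ) (hm : m ≠ 0) : ∃ C : ℝ, 0 ≤ C ∧
    ∀ (n : ℕ) (H : Set (Fin n → ℤ)), (∀ a ∈ H, ∀ b ∈ H, a + b ∈ H) → 0 ∉ H →
      ∀ f : Dom n → ℂ, f ∈ Submodule.span ℂ (boxChar '' H) →
        boxNorm (2 * m : ℕ) f ≤ C * boxNorm (2 * m : ℕ) fun x => (f x).re := by
  obtain ⟨C, hC0, hC⟩ := exists_norm_pow_le m hm
  have hr : (0 : ℝ) < (2 * m : ℕ) := by positivity
  refine ⟨C ^ ((2 * m : ℕ) : ℝ)⁻¹, by positivity, fun n H hadd h0 f hf => ?_⟩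
  have hfc := continuous_of_mem_span hf
  have hz : ∫ x in unitBox n, f x ^ (2 * m) = 0 := by
    have h1 := pow_succ_mem_span hadd hf (2 * m - 1)
    rw [Nat.sub_add_cancel (by omega)] at h1
    exact integral_eq_zero_of_mem_span h0 h1
  have hz' : ∫ x in unitBox n, (f x ^ (2 * m)).re = 0 := by
    have h2 := Complex.reCLM.integral_comp_comm ((hfc.pow (2 * m)).integrable_box)
    simp only [Complex.reCLM_apply, Pi.pow_apply] at h2
    rw [h2, hz, Complex.zero_re]
  have hi1 : Integrable (fun x => C * |(f x).re| ^ (2 * m)) (boxVol n) :=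
    (Continuous.integrable_box (by fun_prop))
  have hi2 : Integrable (fun x => 2 * (-1) ^ m * (f x ^ (2 * m)).re) (boxVol n) :=
    (Continuous.integrable_box (by fun_prop))
  have h3 : ∫ x in unitBox n, ‖f x‖ ^ (2 * m) ≤ C * ∫ x in unitBox n, |(f x).re| ^ (2 * m) := by
    calc _ ≤ ∫ x in unitBox n, (C * |(f x).re| ^ (2 * m) + 2 * (-1) ^ m * (f x ^ (2 * m)).re) :=
          integral_mono (Continuous.integrable_box (by fun_prop)) (hi1.add hi2) fun x => hC (f x)
      _ = _ := by rw [integral_add hi1 hi2, integral_const_mul, integral_const_mul, hz']; ring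
  have h4 : boxNorm (2 * m : ℕ) f ^ ((2 * m : ℕ) : ℝ) ≤
      (C ^ ((2 * m : ℕ) : ℝ)⁻¹ * boxNorm (2 * m : ℕ) fun x => (f x).re) ^ ((2 * m : ℕ) : ℝ) := by
    rw [Real.mul_rpow (by positivity) (boxNorm_nonneg _), Real.rpow_inv_rpow hC0 hr.ne',
      boxNorm_rpow hr, boxNorm_rpow hr]
    simpa only [Real.rpow_natCast, Real.norm_eq_abs] using h3
  exact (Real.rpow_le_rpow_iff (boxNorm_nonneg _)
    (mul_nonneg (by positivity) (boxNorm_nonneg _)) hr).1 h4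

lemma trigPoly_mem_span {S : Finset (Fin n → ℤ)} (hS : ∀ k ∈ S, k ∈ H) (c : (Fin n → ℤ) → ℂ) :
    (fun x : Dom n => ∑ k ∈ S, c k * boxChar k x) ∈ Submodule.span ℂ (boxChar '' H) := by
  have : (fun x : Dom n => ∑ k ∈ S, c k * boxChar k x) = ∑ k ∈ S, c k • boxChar k := by
    ext x
    simp
  rw [this]
  exact Submodule.sum_mem _ fun k hk => Submodule.smul_mem _ _
    (Submodule.subset_span ⟨k, hS k hk, rfl⟩)

/-- M. Riesz's theorem: projections onto half-spaces of frequencies are bounded, uniformly with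
respect to the half-space. -/
lemma exists_isMult_halfSpace (m : ℕ) (hm : m ≠ 0) : ∃ C : ℝ, ∀ (n : ℕ) (H : Set (Fin n → ℤ)),
    (∀ a ∈ H, ∀ b ∈ H, a + b ∈ H) → 0 ∉ H → (∀ k, k ≠ 0 → k ∈ H ∨ -k ∈ H) →
      IsMult (2 * m : ℕ) (H.indicator 1) C := by
  classical
  obtain ⟨C, hC0, hC⟩ := exists_boxNorm_le_re m hm
  have hr1 : (1 : ℝ) ≤ (2 * m : ℕ) := by exact_mod_cast (by omega : 1 ≤ 2 * m)
  have hr : (0 : ℝ) < (2 * m : ℕ) := by linarith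
  refine ⟨2 * C, fun n H hadd h0 hcov S c => ?_⟩
  set r : ℝ := ((2 * m : ℕ) : ℝ)
  set f : Dom n → ℂ := fun x => ∑ k ∈ S, c k * boxChar k x with hf
  set w : Dom n → ℂ := fun x => ∑ k ∈ S with k ∈ H, c k * boxChar k x with hw
  set z : Dom n → ℂ := fun x => ∑ k ∈ S with -k ∈ H, (starRingEnd ℂ) (c k) * boxChar (-k) x
    with hz
  set a : ℂ := ∑ k ∈ S with k = 0, c k with ha
  have hfc : Continuous f := continuous_trigPoly S c
  have hwV : w ∈ Submodule.span ℂ (boxChar '' H) := trigPoly_mem_span (by simp) c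
  have hzV : z ∈ Submodule.span ℂ (boxChar '' H) := by
    have : z = ∑ k ∈ S with -k ∈ H, (starRingEnd ℂ) (c k) • boxChar (-k) := by
      ext x
      simp [hz]
    rw [this]
    exact Submodule.sum_mem _ fun k hk => Submodule.smul_mem _ _
      (Submodule.subset_span ⟨-k, (Finset.mem_filter.1 hk).2, rfl⟩)
  have hdec : ∀ x, f x = a + (w x + (starRingEnd ℂ) (z x)) := fun x => by
    simp only [hf, hw, hz, ha, map_sum, map_mul, boxChar_neg, Complex.conj_conj]
    simp only [Finset.sum_filter, ← Finset.sum_add_distrib]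
    refine Finset.sum_congr rfl fun k _ => ?_
    by_cases hk : k = 0
    · subst hk
      simp [h0, boxChar_zero]
    · by_cases hkH : k ∈ H
      · have : -k ∉ H := fun h => h0 (by simpa using hadd _ hkH _ h)
        simp [hk, hkH, this]
      · have : -k ∈ H := (hcov k hk).resolve_left hkH
        simp [hk, hkH, this]
  have hInt : ∫ x in unitBox n, f x = a := by
    have : ∀ k ∈ S, Integrable (fun x => c k * boxChar k x) (boxVol n) := fun k _ =>
      (continuous_const.mul (continuous_boxChar k)).integrable_box
    rw [hf, integral_finsetSum _ this, ha, Finset.sum_filter]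
    refine Finset.sum_congr rfl fun k _ => ?_
    rw [integral_const_mul]
    by_cases hk : k = 0
    · subst hk
      simp [boxChar_zero]
    · rw [integral_boxChar_of_ne_zero hk]
      simp [hk]
  have hg : boxNorm r (fun x => w x + (starRingEnd ℂ) (z x)) ≤ 2 * boxNorm r f := by
    have e : (fun x => w x + (starRingEnd ℂ) (z x)) = fun x => f x + (-a) := by
      ext x
      rw [hdec]
      ring
    rw [e]
    refine (boxNorm_add_le hr1 hfc continuous_const).trans ?_
    rw [boxNorm_const hr, norm_neg, two_mul]
    gcongr
    rw [← hInt]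
    exact norm_integral_le_boxNorm hr1 hfc
  have hwc := continuous_of_mem_span hwV
  have hzc := continuous_of_mem_span hzV
  have hgc : Continuous fun x => (1 / 2 : ℂ) * (w x + (starRingEnd ℂ) (z x)) := by fun_prop
  have b1 : boxNorm r (fun x => (1 / 2 : ℂ) * (w x + z x)) ≤ C * boxNorm r f := by
    refine (hC n H hadd h0 _ (Submodule.smul_mem _ (1 / 2 : ℂ)
      (Submodule.add_mem _ hwV hzV))).trans ?_
    refine mul_le_mul_of_nonneg_left ?_ hC0
    calc _ ≤ boxNorm r (fun x => (1 / 2 : ℂ) * (w x + (starRingEnd ℂ) (z x))) := by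
          refine boxNorm_mono hr (Complex.continuous_re.comp (continuous_const.mul
            (hwc.add hzc))) hgc fun x => ?_
          have : ((1 / 2 : ℂ) * (w x + z x)).re =
              ((1 / 2 : ℂ) * (w x + (starRingEnd ℂ) (z x))).re := by
            simp
          simp only [Pi.smul_apply, Pi.add_apply, smul_eq_mul]
          rw [this, Real.norm_eq_abs]
          exact Complex.abs_re_le_norm _
      _ ≤ _ := by
          rw [boxNorm_const_mul hr]
          norm_num
          linarith
  have b2 : boxNorm r (fun x => (-I / 2 : ℂ) * (w x - z x)) ≤ C * boxNorm r f := by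
    refine (hC n H hadd h0 _ (Submodule.smul_mem _ (-I / 2 : ℂ)
      (Submodule.sub_mem _ hwV hzV))).trans ?_
    refine mul_le_mul_of_nonneg_left ?_ hC0
    calc _ ≤ boxNorm r (fun x => (1 / 2 : ℂ) * (w x + (starRingEnd ℂ) (z x))) := by
          refine boxNorm_mono hr (Complex.continuous_re.comp (continuous_const.mul
            (hwc.sub hzc))) hgc fun x => ?_
          have : ((-I / 2 : ℂ) * (w x - z x)).re =
              ((1 / 2 : ℂ) * (w x + (starRingEnd ℂ) (z x))).im := by
            simp
            ring
          simp only [Pi.smul_apply, Pi.sub_apply, smul_eq_mul]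
          rw [this, Real.norm_eq_abs]
          exact Complex.abs_im_le_norm _
      _ ≤ _ := by
          rw [boxNorm_const_mul hr]
          norm_num
          linarith
  have e : (fun x : Dom n => ∑ k ∈ S, (((H.indicator 1 k : ℝ) : ℂ) * c k) * boxChar k x) =
      fun x => (1 / 2 : ℂ) * (w x + z x) + I * ((-I / 2 : ℂ) * (w x - z x)) := by
    ext x
    have : I * ((-I / 2 : ℂ) * (w x - z x)) = (w x - z x) / 2 := by
      linear_combination (-(w x - z x) / 2) * I_mul_I
    rw [this, show (1 / 2 : ℂ) * (w x + z x) + (w x - z x) / 2 = w x by ring]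
    simp only [hw, Finset.sum_filter]
    refine Finset.sum_congr rfl fun k _ => ?_
    by_cases hk : k ∈ H <;> simp [hk]
  rw [e]
  refine (boxNorm_add_le hr1 (by fun_prop) (by fun_prop)).trans ?_
  rw [boxNorm_const_mul hr I, norm_I]
  linarith

end Riesz

/-! ### Multipliers localized to sectors of frequencies -/

section Sector

variable {n : ℕ} {r : ℝ} {μ ν : (Fin n → ℤ) → ℝ} {C D : ℝ}

lemma IsMult.congr (h : IsMult r μ C) (e : ∀ k, μ k = ν k) : IsMult r ν C :=
  (funext e : μ = ν) ▸ h

lemma exists_isMult_pos (m : ℕ) (hm : m ≠ 0) : ∃ C : ℝ, ∀ (n : ℕ) (l : (Fin n → ℤ) →+ ℝ),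
    IsMult (2 * m : ℕ) ({k | 0 < l k}.indicator 1) C := by
  obtain ⟨C, hC⟩ := exists_isMult_halfSpace m hm
  have hr : (0 : ℝ) < (2 * m : ℕ) := by positivity
  refine ⟨C * C, fun n l => ?_⟩
  have key : ∀ (P : (Fin n → ℤ) → Prop), (∀ a b, P a → P b → P (a + b)) → ¬ P 0 →
      (∀ k, k ≠ 0 → P k ∨ P (-k)) →
      IsMult (2 * m : ℕ) ({k | 0 < l k ∨ l k = 0 ∧ P k}.indicator 1) C := by
    intro P hadd h0 hcov
    refine hC n _ ?_ ?_ ?_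
    · rintro a (ha | ⟨ha, ha'⟩) b (hb | ⟨hb, hb'⟩)
      · exact Or.inl (by rw [map_add]; linarith)
      · exact Or.inl (by rw [map_add]; linarith)
      · exact Or.inl (by rw [map_add]; linarith)
      · exact Or.inr ⟨by rw [map_add, ha, hb, add_zero], hadd _ _ ha' hb'⟩
    · simp [h0]
    · intro k hk
      rcases lt_trichotomy (l k) 0 with h | h | h
      · exact Or.inr (Or.inl (by rw [map_neg]; linarith))
      · rcases hcov k hk with h' | h'
        · exact Or.inl (Or.inr ⟨h, h'⟩)
        · exact Or.inr (Or.inr ⟨by rw [map_neg, h, neg_zero], h'⟩)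
      · exact Or.inl (Or.inl h)
  have htri : ∀ k : Fin n → ℤ, k ≠ 0 → 0 < toLex k ∨ 0 < toLex (-k) := fun k hk => by
    rcases lt_trichotomy (toLex k) 0 with h | h | h
    · exact Or.inr (by rw [toLex_neg]; exact neg_pos.2 h)
    · exact absurd (toLex_eq_zero.1 h) hk
    · exact Or.inl h
  have h1 := key (fun k => 0 < toLex k) (fun a b ha hb => by
    simp only [toLex_add]; exact add_pos ha hb) (lt_irrefl _) htri
  have h2 := key (fun k => 0 < toLex (-k)) (fun a b ha hb => by
    simp only [neg_add, toLex_add]; exact add_pos ha hb) (lt_irrefl _)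
    (fun k hk => by simpa using (htri k hk).symm)
  refine (h1.mul hr h2).congr fun k => ?_
  have h3 : ¬ (0 < toLex k ∧ 0 < toLex (-k)) := fun ⟨h, h'⟩ => by
    rw [toLex_neg] at h'
    exact absurd (neg_pos.1 h') h.not_gt
  have hmem : ∀ (P : Prop) (Q : Set (Fin n → ℤ)), (k ∈ Q ↔ P) → ¬ P →
      Q.indicator (1 : (Fin n → ℤ) → ℝ) k = 0 := fun P Q h h' =>
    Set.indicator_of_notMem (fun hk => h' (h.1 hk)) _
  by_cases hl : 0 < l k
  · have hmem' : ∀ Q : Set (Fin n → ℤ), k ∈ Q → Q.indicator (1 : (Fin n → ℤ) → ℝ) k = 1 :=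
      fun Q h => Set.indicator_of_mem h _
    rw [hmem' _ (Or.inl hl), hmem' _ (Or.inl hl), hmem' _ hl, mul_one]
  · rw [hmem _ {k | 0 < l k} Iff.rfl hl]
    by_cases ha : 0 < toLex k
    · have hb : ¬ 0 < toLex (-k) := fun h => h3 ⟨ha, h⟩
      exact mul_eq_zero_of_right _ (hmem _ _ Iff.rfl fun h => h.elim hl fun h => hb h.2)
    · exact mul_eq_zero_of_left (hmem _ _ Iff.rfl fun h => h.elim hl fun h => ha h.2) _

/-- The frequencies whose slope `k j / k i` exceeds `t`. -/
def slopeGT (i j : Fin n) (t : ℝ) : Set (Fin n → ℤ) := {k | k i ≠ 0 ∧ t < k j / k i}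

/-- The frequencies whose slopes are `δ`-close to `s`. -/
def slopeCell (i : Fin n) (s : Fin n → ℝ) (δ : ℝ) : Set (Fin n → ℤ) :=
  {k | k i ≠ 0 ∧ ∀ j, s j - δ < k j / k i ∧ k j / k i ≤ s j + δ}

lemma exists_isMult_slopeGT (m : ℕ) (hm : m ≠ 0) : ∃ C : ℝ, ∀ (n : ℕ) (i j : Fin n) (t : ℝ),
    IsMult (2 * m : ℕ) ((slopeGT i j t).indicator 1) C := by
  obtain ⟨C, hC⟩ := exists_isMult_pos m hm
  have hr1 : (1 : ℝ) ≤ (2 * m : ℕ) := by exact_mod_cast (by omega : 1 ≤ 2 * m)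
  have hr : (0 : ℝ) < (2 * m : ℕ) := by linarith
  refine ⟨C * C + C * C, fun n i j t => ?_⟩
  let ev : Fin n → (Fin n → ℤ) →+ ℝ := fun i =>
    (Int.castAddHom ℝ).comp (Pi.evalAddMonoidHom (fun _ => ℤ) i)
  let l : (Fin n → ℤ) →+ ℝ := ev j - (AddMonoidHom.mulLeft t).comp (ev i)
  have hl : ∀ k, l k = k j - t * k i := fun k => rfl
  have he : ∀ k, ev i k = k i := fun k => rfl
  refine (((hC n l).mul hr (hC n (ev i))).add hr1
    ((hC n (-l)).mul hr (hC n (-ev i)))).congr fun k => ?_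
  simp only [Set.indicator_apply, Set.mem_ofPred_eq, Pi.one_apply, AddMonoidHom.neg_apply, hl, he,
    slopeGT]
  rcases lt_trichotomy (k i : ℝ) 0 with h | h | h
  · have h1 : t < (k j : ℝ) / k i ↔ 0 < -((k j : ℝ) - t * k i) := by
      rw [lt_div_iff_of_neg h]
      constructor <;> intro <;> linarith
    have h2 : (k i : ℤ) ≠ 0 := by exact_mod_cast h.ne
    simp [h1, h2, h, h.not_gt]
  · have h2 : (k i : ℤ) = 0 := by exact_mod_cast h
    simp [h2]
  · have h1 : t < (k j : ℝ) / k i ↔ 0 < ((k j : ℝ) - t * k i) := by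
      rw [lt_div_iff₀ h]
      constructor <;> intro <;> linarith
    have h2 : (k i : ℤ) ≠ 0 := by exact_mod_cast h.ne'
    simp only [h1, h2, h, Left.neg_pos_iff, h.not_gt, if_false, mul_zero, add_zero, if_true,
      mul_one, ne_eq, not_false_eq_true, true_and]

/-- `μ` has the limit `c` at the direction `s`, in the multiplier norm. -/
def GermMult (r : ℝ) (i : Fin n) (s : Fin n → ℝ) (μ : (Fin n → ℤ) → ℝ) (c : ℝ) : Prop :=
  ∀ ε > 0, ∀ᶠ δ in 𝓝[>] (0 : ℝ), IsMult r ((slopeCell i s δ).indicator fun k => μ k - c) ε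

lemma indicator_slopeCell_eq_prod (i : Fin n) (s : Fin n → ℝ) {δ : ℝ} (hδ : 0 < δ)
    (k : Fin n → ℤ) : (slopeCell i s δ).indicator (1 : (Fin n → ℤ) → ℝ) k =
      ∏ j, ((slopeGT i j (s j - δ)).indicator (1 : (Fin n → ℤ) → ℝ) k -
        (slopeGT i j (s j + δ)).indicator 1 k) := by
  have h1 : ∀ j, ((slopeGT i j (s j - δ)).indicator (1 : (Fin n → ℤ) → ℝ) k -
        (slopeGT i j (s j + δ)).indicator 1 k) =
      if k i ≠ 0 ∧ s j - δ < (k j : ℝ) / k i ∧ (k j : ℝ) / k i ≤ s j + δ then 1 else 0 := fun j => by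
    simp only [Set.indicator_apply, Set.mem_ofPred_eq, Pi.one_apply, slopeGT]
    by_cases h0 : k i = 0
    · simp [h0]
    · by_cases ha : s j - δ < (k j : ℝ) / k i <;> by_cases hb : s j + δ < (k j : ℝ) / k i
      · simp [ha, hb, h0]
      · simp [ha, hb, h0, not_lt.1 hb]
      · linarith
      · simp [ha, hb, h0]
  simp_rw [h1]
  rw [Finset.prod_ite_zero]
  simp only [Set.indicator_apply, Set.mem_ofPred_eq, Pi.one_apply, slopeCell, Finset.prod_const_one,
    Finset.mem_univ, forall_const, forall_and]
  have : (∀ _ : Fin n, k i ≠ 0) ↔ k i ≠ 0 := ⟨fun h => h i, fun h _ => h⟩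
  simp only [this]

lemma tendsto_riemann {y : ℝ} (hy : 0 < y) (hy1 : y ≤ 1) :
    Tendsto (fun N : ℕ => (∑ l ∈ Finset.range N, if (l : ℝ) / N < y then (1 : ℝ) else 0) / N)
      atTop (𝓝 y) := by
  have h := (tendsto_nat_ceil_mul_div_atTop hy.le).comp (tendsto_natCast_atTop_atTop (R := ℝ))
  refine h.congr' ?_
  filter_upwards [eventually_gt_atTop 0] with N hN
  have hN' : (0 : ℝ) < N := by exact_mod_cast hN
  have hf : (Finset.range N).filter (fun l : ℕ => (l : ℝ) / N < y) = Finset.range ⌈y * N⌉₊ := by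
    ext l
    simp only [Finset.mem_filter, Finset.mem_range, Nat.lt_ceil, div_lt_iff₀ hN']
    refine ⟨fun h => h.2, fun h => ⟨?_, h⟩⟩
    have : (l : ℝ) < N := h.trans_le (by nlinarith)
    exact_mod_cast this
  simp only [Function.comp]
  rw [← Finset.sum_filter, hf]
  simp

/-- Multiplier bounds for sectors. -/
lemma exists_isMult_slopeCell (m : ℕ) (hm : m ≠ 0) (n : ℕ) : ∃ C : ℝ, ∀ (i : Fin n)
    (s : Fin n → ℝ) (δ : ℝ), 0 < δ → IsMult (2 * m : ℕ) ((slopeCell i s δ).indicator 1) C ∧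
      ∀ j, IsMult (2 * m : ℕ) ((slopeCell i s δ).indicator fun k => k j / k i - s j) (C * δ) := by
  obtain ⟨C, hC⟩ := exists_isMult_slopeGT m hm
  have hr1 : (1 : ℝ) ≤ (2 * m : ℕ) := by exact_mod_cast (by omega : 1 ≤ 2 * m)
  have hr : (0 : ℝ) < (2 * m : ℕ) := by linarith
  set B : ℝ := ∏ _j : Fin n, (C + C) with hB
  suffices h : ∀ (i : Fin n) (s : Fin n → ℝ) (δ : ℝ), 0 < δ →
      IsMult (2 * m : ℕ) ((slopeCell i s δ).indicator 1) B ∧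
      ∀ j, IsMult (2 * m : ℕ) ((slopeCell i s δ).indicator fun k => k j / k i - s j)
        (B * (2 * C + 1) * δ) by
    refine ⟨max B (B * (2 * C + 1)), fun i s δ hδ => ⟨(h i s δ hδ).1.mono (le_max_left _ _),
      fun j => ((h i s δ hδ).2 j).mono ?_⟩⟩
    exact mul_le_mul_of_nonneg_right (le_max_right _ _) hδ.le
  intro i s δ hδ
  have hT : IsMult (2 * m : ℕ) ((slopeCell i s δ).indicator 1) B :=
    (IsMult.prod hr Finset.univ fun j _ => (hC n i j (s j - δ)).sub hr1
      (hC n i j (s j + δ))).congr fun k => (indicator_slopeCell_eq_prod i s hδ k).symm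
  refine ⟨hT, fun j => ?_⟩
  have hC0 : 0 ≤ C := (hC n i j 0).nonneg hr
  have hN : ∀ N : ℕ, IsMult (2 * m : ℕ) (fun k => (slopeCell i s δ).indicator 1 k *
      (2 * δ / (N + 1 : ℕ) * (∑ l ∈ Finset.range (N + 1),
        (slopeGT i j (s j - δ + 2 * δ * (l / (N + 1 : ℕ)))).indicator 1 k) + (-δ)))
        (B * (2 * C + 1) * δ) := fun N => by
    have hN0 : (0 : ℝ) < (N + 1 : ℕ) := by positivity
    refine (hT.mul hr (((IsMult.sum hr1 (Finset.range (N + 1)) fun l _ =>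
      hC n i j (s j - δ + 2 * δ * (l / (N + 1 : ℕ)))).const_mul hr _).add hr1
        (isMult_const hr (-δ)))).mono (le_of_eq ?_)
    rw [abs_neg, abs_of_pos hδ, abs_of_pos (by positivity), Finset.sum_const, Finset.card_range,
      nsmul_eq_mul]
    field_simp
  refine IsMult.of_tendsto hr1 hN tendsto_const_nhds fun k => ?_
  by_cases hk : k ∈ slopeCell i s δ
  · simp only [Set.indicator_of_mem hk, Pi.one_apply, one_mul]
    set y : ℝ := (k j / k i - (s j - δ)) / (2 * δ) with hy
    have h2 := hk.2 j
    have hy0 : 0 < y := div_pos (by linarith) (by linarith)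
    have hy1 : y ≤ 1 := (div_le_one (by linarith)).2 (by linarith)
    have h3 := ((tendsto_riemann hy0 hy1).comp (tendsto_add_atTop_nat 1)).const_mul (2 * δ)
    have h4 := h3.add_const (-δ)
    have e : 2 * δ * y + -δ = k j / k i - s j := by
      rw [hy]
      field_simp
      ring
    rw [e] at h4
    refine h4.congr fun N => ?_
    simp only [Function.comp]
    rw [mul_div_assoc', div_mul_eq_mul_div]
    congr 3
    refine Finset.sum_congr rfl fun l _ => ?_
    simp only [Set.indicator_apply, slopeGT, Set.mem_ofPred_eq, Pi.one_apply]
    refine if_congr ?_ rfl rfl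
    rw [hy, lt_div_iff₀ (by linarith)]
    constructor
    · intro h
      exact ⟨hk.1, by linarith⟩
    · rintro ⟨-, h⟩
      linarith
  · simp [hk]

end Sector

/-! ### Germs of multipliers and matrix symbols -/

section Germ

variable {n : ℕ} {r : ℝ} {i : Fin n} {s : Fin n → ℝ} {μ ν : (Fin n → ℤ) → ℝ} {c d : ℝ}

lemma IsMult.pow {C : ℝ} (hr : 0 < r) (h : IsMult r μ C) (l : ℕ) :
    IsMult r (fun k => μ k ^ l) (C ^ l) := by
  simpa using IsMult.prod hr (Finset.range l) fun _ _ => h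

lemma germMult_const (hr : 0 < r) (c : ℝ) : GermMult r i s (fun _ => c) c := fun ε hε =>
  Eventually.of_forall fun δ => ((isMult_const hr 0).mono (by simpa using hε.le)).congr
    fun k => by simp

lemma GermMult.add (hr : 1 ≤ r) (h : GermMult r i s μ c) (h' : GermMult r i s ν d) :
    GermMult r i s (fun k => μ k + ν k) (c + d) := fun ε hε => by
  filter_upwards [h (ε / 2) (half_pos hε), h' (ε / 2) (half_pos hε)] with δ h1 h2
  refine ((h1.add hr h2).mono (by linarith)).congr fun k => ?_
  by_cases hk : k ∈ slopeCell i s δ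
  · simp only [Set.indicator_of_mem hk]
    ring
  · simp [hk]

lemma GermMult.mul (hr : 1 ≤ r) (h : GermMult r i s μ c) (h' : GermMult r i s ν d) :
    GermMult r i s (fun k => μ k * ν k) (c * d) := fun ε hε => by
  have hr0 : 0 < r := by linarith
  set η : ℝ := min 1 (ε / (1 + |c| + |d|)) with hη
  have hp : 0 < 1 + |c| + |d| := by positivity
  have hη0 : 0 < η := lt_min one_pos (div_pos hε hp)
  have hηε : η * (1 + |c| + |d|) ≤ ε := (le_div_iff₀ hp).1 (min_le_right _ _)
  filter_upwards [h η hη0, h' η hη0] with δ h1 h2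
  have h3 := ((h1.mul hr0 h2).add hr (h2.const_mul hr0 c)).add hr (h1.const_mul hr0 d)
  refine (h3.mono ?_).congr fun k => ?_
  · have : η * η ≤ η * 1 := mul_le_mul_of_nonneg_left (min_le_left _ _) hη0.le
    linarith
  · by_cases hk : k ∈ slopeCell i s δ
    · simp only [Set.indicator_of_mem hk]
      ring
    · simp [hk]

lemma GermMult.sum (hr : 1 ≤ r) {ι : Type*} (t : Finset ι) {μ : ι → (Fin n → ℤ) → ℝ} {c : ι → ℝ}
    (h : ∀ a ∈ t, GermMult r i s (μ a) (c a)) :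
    GermMult r i s (fun k => ∑ a ∈ t, μ a k) (∑ a ∈ t, c a) := by
  classical
  induction t using Finset.induction_on with
  | empty => simpa using germMult_const (by linarith) 0
  | insert a t ha ih =>
    simp only [Finset.sum_insert ha]
    exact (h a (by simp)).add hr (ih fun i hi => h i (by simp [hi]))

lemma GermMult.prod (hr : 1 ≤ r) {ι : Type*} (t : Finset ι) {μ : ι → (Fin n → ℤ) → ℝ} {c : ι → ℝ}
    (h : ∀ a ∈ t, GermMult r i s (μ a) (c a)) :
    GermMult r i s (fun k => ∏ a ∈ t, μ a k) (∏ a ∈ t, c a) := by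
  classical
  induction t using Finset.induction_on with
  | empty => simpa using germMult_const (by linarith) 1
  | insert a t ha ih =>
    simp only [Finset.prod_insert ha]
    exact (h a (by simp)).mul hr (ih fun i hi => h i (by simp [hi]))

lemma GermMult.inv (hr : 1 ≤ r) (h : GermMult r i s μ c) (hc : c ≠ 0) :
    GermMult r i s (fun k => (μ k)⁻¹) c⁻¹ := fun ε hε => by
  have hr0 : 0 < r := by linarith
  have hc' : 0 < |c| := abs_pos.2 hc
  set η : ℝ := min (1 / 2) (ε * |c| / 2) with hη
  have hη0 : 0 < η := lt_min (by norm_num) (by positivity)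
  have hη2 : η ≤ 1 / 2 := min_le_left _ _
  filter_upwards [h (η * |c|) (by positivity)] with δ h1
  set e : (Fin n → ℤ) → ℝ := fun k => -c⁻¹ * (slopeCell i s δ).indicator (fun k => μ k - c) k
    with he
  have h2 : IsMult r e η := by
    refine (h1.const_mul hr0 (-c⁻¹)).mono (le_of_eq ?_)
    rw [abs_neg, abs_inv]
    field_simp
  have habs : ∀ k, |e k| ≤ 1 / 2 := fun k => (h2.abs_le hr0 k).trans hη2
  have h3 : ∀ L : ℕ, IsMult r (fun k => c⁻¹ * ((∑ l ∈ Finset.range L, e k ^ l) * e k))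
      (|c⁻¹| * ((∑ l ∈ Finset.range L, η ^ l) * η)) := fun L =>
    ((IsMult.sum hr _ fun l _ => h2.pow hr0 l).mul hr0 h2).const_mul hr0 _
  have hlim : ∀ x : ℝ, |x| ≤ 1 / 2 → ∀ y z : ℝ, Tendsto (fun L : ℕ =>
      y * ((∑ l ∈ Finset.range L, x ^ l) * z)) atTop (𝓝 (y * ((1 - x)⁻¹ * z))) := fun x hx y z =>
    (((hasSum_geometric_of_abs_lt_one (by linarith)).tendsto_sum_nat).mul_const z).const_mul y
  have h4 := IsMult.of_tendsto hr h3 (hlim η (by rwa [abs_of_pos hη0]) _ _)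
    fun k => hlim (e k) (habs k) c⁻¹ (e k)
  refine (h4.mono ?_).congr fun k => ?_
  · have h5 : (1 - η)⁻¹ ≤ 2 := by
      rw [inv_le_comm₀ (by linarith) (by norm_num)]
      linarith
    calc |c⁻¹| * ((1 - η)⁻¹ * η) ≤ |c⁻¹| * (2 * (ε * |c| / 2)) := by
          gcongr
          exact min_le_right _ _
      _ = ε := by
          rw [abs_inv]
          field_simp
  · by_cases hk : k ∈ slopeCell i s δ
    · have h5 : e k = 1 - c⁻¹ * μ k := by
        simp only [he, Set.indicator_of_mem hk]
        field_simp
        ring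
      have h6 : μ k ≠ 0 := by
        intro h0
        have := habs k
        rw [h5, h0, mul_zero, sub_zero, abs_one] at this
        norm_num at this
      rw [Set.indicator_of_mem hk, h5]
      have : (1 - (1 - c⁻¹ * μ k)) = c⁻¹ * μ k := by ring
      rw [this]
      field_simp
    · simp [he, hk]

lemma GermMult.det (hr : 1 ≤ r) {a : ℕ} {M : (Fin n → ℤ) → Matrix (Fin a) (Fin a) ℝ}
    {M₀ : Matrix (Fin a) (Fin a) ℝ} (h : ∀ p q, GermMult r i s (fun k => M k p q) (M₀ p q)) :
    GermMult r i s (fun k => (M k).det) M₀.det := by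
  simp only [Matrix.det_apply']
  exact GermMult.sum hr _ fun σ _ => (germMult_const (by linarith) _).mul hr
    (GermMult.prod hr _ fun p _ => h _ _)

lemma GermMult.adjugate (hr : 1 ≤ r) {a : ℕ} {M : (Fin n → ℤ) → Matrix (Fin a) (Fin a) ℝ}
    {M₀ : Matrix (Fin a) (Fin a) ℝ} (h : ∀ p q, GermMult r i s (fun k => M k p q) (M₀ p q))
    (p q : Fin a) : GermMult r i s (fun k => (M k).adjugate p q) (M₀.adjugate p q) := by
  simp only [Matrix.adjugate_apply]
  refine GermMult.det hr fun p' q' => ?_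
  by_cases hp : p' = q
  · subst hp
    simpa using germMult_const (by linarith) _
  · simpa [Matrix.updateRow_ne hp] using h p' q'

lemma GermMult.matrix_mul (hr : 1 ≤ r) {a b c : ℕ} {M : (Fin n → ℤ) → Matrix (Fin a) (Fin b) ℝ}
    {M₀ : Matrix (Fin a) (Fin b) ℝ} {M' : (Fin n → ℤ) → Matrix (Fin b) (Fin c) ℝ}
    {M₀' : Matrix (Fin b) (Fin c) ℝ} (h : ∀ p q, GermMult r i s (fun k => M k p q) (M₀ p q))
    (h' : ∀ p q, GermMult r i s (fun k => M' k p q) (M₀' p q)) (p : Fin a) (q : Fin c) :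
    GermMult r i s (fun k => (M k * M' k) p q) ((M₀ * M₀') p q) := by
  simp only [Matrix.mul_apply]
  exact GermMult.sum hr _ fun l _ => (h _ _).mul hr (h' _ _)

lemma GermMult.matrix_inv (hr : 1 ≤ r) {a : ℕ} {M : (Fin n → ℤ) → Matrix (Fin a) (Fin a) ℝ}
    (h : ∀ p q, GermMult r i s (fun k => M k p q) ((1 : Matrix (Fin a) (Fin a) ℝ) p q))
    (p q : Fin a) :
    GermMult r i s (fun k => (M k)⁻¹ p q) ((1 : Matrix (Fin a) (Fin a) ℝ) p q) := by
  simp only [Matrix.inv_def, Ring.inverse_eq_inv', Matrix.smul_apply, smul_eq_mul]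
  have := ((GermMult.det hr h).inv hr (by simp)).mul hr (GermMult.adjugate hr h p q)
  simpa using this

lemma germMult_slope (m : ℕ) (hm : m ≠ 0) (i j : Fin n) (s : Fin n → ℝ) :
    GermMult (2 * m : ℕ) i s (fun k => k j / k i) (s j) := fun ε hε => by
  obtain ⟨C, hC⟩ := exists_isMult_slopeCell m hm n
  have hC0 : 0 ≤ C := (hC i s 1 one_pos).1.nonneg (by positivity)
  have hlt : ∀ᶠ δ in 𝓝[>] (0 : ℝ), δ < ε / (C + 1) :=
    (eventually_lt_nhds (by positivity)).filter_mono nhdsWithin_le_nhds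
  filter_upwards [self_mem_nhdsWithin, hlt] with δ hδ hδ'
  refine ((hC i s δ hδ).2 j).mono ?_
  rw [lt_div_iff₀ (by positivity)] at hδ'
  have : (0 : ℝ) < δ := hδ
  nlinarith

/-- A germ becomes a genuine multiplier after localization. -/
lemma GermMult.exists_isMult (hr : 1 ≤ r) (h : GermMult r i s μ c) {B : ℝ}
    (hB : ∀ δ > 0, IsMult r ((slopeCell i s δ).indicator 1) B) :
    ∀ᶠ δ in 𝓝[>] (0 : ℝ), IsMult r ((slopeCell i s δ).indicator μ) (1 + |c| * B) := by
  filter_upwards [h 1 one_pos, self_mem_nhdsWithin] with δ h1 h2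
  refine (h1.add hr ((hB δ h2).const_mul (by linarith) c)).congr fun k => ?_
  by_cases hk : k ∈ slopeCell i s δ <;> simp [hk]

end Germ

/-! ### Linear algebra of the symbol -/

section Symbol

open Matrix in
lemma exists_generalized_inverse {a b : ℕ} (A : Matrix (Fin a) (Fin b) ℝ) :
    ∃ R : Matrix (Fin b) (Fin a) ℝ, A * R * A = A := by
  set f := A.toLin' with hf
  obtain ⟨g, hg⟩ := f.rangeRestrict.exists_rightInverse_of_surjective f.range_rangeRestrict
  obtain ⟨p, hp⟩ := f.range.subtype.exists_leftInverse_of_injective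
    (Submodule.ker_subtype _)
  refine ⟨LinearMap.toMatrix' (g ∘ₗ p), ?_⟩
  apply Matrix.toLin'.injective
  rw [Matrix.toLin'_mul, Matrix.toLin'_mul, Matrix.toLin'_toMatrix', ← hf]
  refine LinearMap.ext fun v => ?_
  have h1 : p (f v) = f.rangeRestrict v := LinearMap.congr_fun hp (f.rangeRestrict v)
  have h2 : f.rangeRestrict (g (f.rangeRestrict v)) = f.rangeRestrict v :=
    LinearMap.congr_fun hg _
  change f (g (p (f v))) = f v
  rw [h1]
  exact congrArg Subtype.val h2

/-- If `A` has the same rank as `A₀` and `Z = 1 + R (A - A₀)` is invertible, then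
`Z⁻¹ (1 - R A₀)` maps into the kernel of `A`. -/
lemma mul_inv_mul_eq_zero {a b : ℕ} {A A₀ : Matrix (Fin a) (Fin b) ℝ}
    {R : Matrix (Fin b) (Fin a) ℝ} (hR : A₀ * R * A₀ = A₀) (hrank : A.rank = A₀.rank)
    (hZ : IsUnit ((1 - R * A₀) + R * A).det) :
    A * (((1 - R * A₀) + R * A)⁻¹ * (1 - R * A₀)) = 0 := by
  set P := 1 - R * A₀ with hP
  set Z := P + R * A with hZdef
  set Q := Z⁻¹ * P with hQ
  have hZZ : Z⁻¹ * Z = 1 := Matrix.nonsing_inv_mul _ hZ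
  have hsub : A.mulVecLin.ker ≤ Q.mulVecLin.range := by
    intro x hx
    have hx' : A.mulVec x = 0 := hx
    refine ⟨x, ?_⟩
    have h1 : Z.mulVec x = P.mulVec x := by
      rw [hZdef, Matrix.add_mulVec, ← Matrix.mulVec_mulVec, hx', Matrix.mulVec_zero, add_zero]
    rw [Matrix.mulVecLin_apply, hQ, ← Matrix.mulVec_mulVec, ← h1, Matrix.mulVec_mulVec, hZZ,
      Matrix.one_mulVec]
  have hPker : P.mulVecLin.range ≤ A₀.mulVecLin.ker := by
    rintro _ ⟨x, rfl⟩
    rw [LinearMap.mem_ker, Matrix.mulVecLin_apply, Matrix.mulVecLin_apply, Matrix.mulVec_mulVec,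
      hP, Matrix.mul_sub, ← Matrix.mul_assoc, hR, Matrix.mul_one, sub_self, Matrix.zero_mulVec]
  have d1 : Module.finrank ℝ Q.mulVecLin.range ≤ Module.finrank ℝ A.mulVecLin.ker := by
    have e1 : Q.rank ≤ P.rank := Matrix.rank_mul_le_right _ _
    have e2 := Submodule.finrank_mono hPker
    have e3 := A₀.mulVecLin.finrank_range_add_finrank_ker
    have e4 := A.mulVecLin.finrank_range_add_finrank_ker
    simp only [Matrix.rank] at e1 hrank
    omega
  have heq := Submodule.eq_of_le_of_finrank_le hsub d1
  apply Matrix.toLin'.injective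
  refine LinearMap.ext fun x => ?_
  have : Q.mulVec x ∈ A.mulVecLin.ker := heq ▸ ⟨x, rfl⟩
  simp only [LinearMap.mem_ker, Matrix.mulVecLin_apply, Matrix.mulVec_mulVec] at this
  rw [Matrix.toLin'_apply, this, map_zero, LinearMap.zero_apply]

variable {n d N K : ℕ}

lemma opMatrix_smul (A : (Fin K → Fin n) → (Ed d →ₗ[ℝ] Ed N)) (t : ℝ) (ξ : Fin n → ℝ) :
    opMatrix A (t • ξ) = t ^ K • opMatrix A ξ := by
  ext i j
  simp only [opMatrix, Matrix.smul_apply, smul_eq_mul, Finset.mul_sum, Pi.smul_apply,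
    Finset.prod_mul_distrib, Finset.prod_const, Finset.card_univ, Fintype.card_fin, mul_assoc]

lemma rank_opMatrix (A : (Fin K → Fin n) → (Ed d →ₗ[ℝ] Ed N)) (ξ : Fin n → ℝ) :
    (opMatrix A ξ).rank = Module.finrank ℝ (LinearMap.range (opSymbol A ξ)) := by
  have h : (opMatrix A ξ).mulVecLin = (WithLp.linearEquiv 2 ℝ (Fin N → ℝ)).toLinearMap ∘ₗ
      opSymbol A ξ ∘ₗ (WithLp.linearEquiv 2 ℝ (Fin d → ℝ)).symm.toLinearMap := by
    refine LinearMap.ext fun v => funext fun i => ?_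
    have h1 := linearMap_apply_eq_sum (opSymbol A ξ) (WithLp.toLp 2 v) i
    refine Eq.trans ?_ h1.symm
    rw [Matrix.mulVecLin_apply, Matrix.mulVec, dotProduct]
    refine Finset.sum_congr rfl fun j _ => ?_
    simp [opMatrix, opSymbol, Finset.sum_apply]
  rw [Matrix.rank, h, LinearMap.range_comp, LinearMap.range_comp, LinearEquiv.range,
    Submodule.map_top]
  exact LinearEquiv.finrank_map_eq _ _

end Symbol

/-! ### Parametrices of symbols of constant rank -/

section SymbolMultiplier

variable {n d N K : ℕ}

lemma opMatrix_intCast_eq (A : (Fin K → Fin n) → (Ed d →ₗ[ℝ] Ed N)) {k : Fin n → ℤ} {i : Fin n}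
    (hi : k i ≠ 0) : opMatrix A (fun l => (k l : ℝ)) =
      (k i : ℝ) ^ K • opMatrix A fun j => (k j : ℝ) / k i := by
  have hi' : (k i : ℝ) ≠ 0 := by exact_mod_cast hi
  rw [← opMatrix_smul]
  congr 1
  ext j
  simp only [Pi.smul_apply, smul_eq_mul]
  field_simp

lemma germMult_opMatrix (A : (Fin K → Fin n) → (Ed d →ₗ[ℝ] Ed N)) (m : ℕ) (hm : m ≠ 0)
    (i : Fin n) (s : Fin n → ℝ) (p : Fin N) (q : Fin d) :
    GermMult (2 * m : ℕ) i s (fun k => opMatrix A (fun j => (k j : ℝ) / k i) p q)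
      (opMatrix A s p q) := by
  have hr1 : (1 : ℝ) ≤ (2 * m : ℕ) := by exact_mod_cast (by omega : 1 ≤ 2 * m)
  simp only [opMatrix]
  exact GermMult.sum hr1 _ fun α _ => (GermMult.prod hr1 _ fun l _ =>
    germMult_slope m hm i (α l) s).mul hr1 (germMult_const (by linarith) _)

/-- A bounded parametrix of the symbol in a sector of frequencies. -/
lemma exists_sector_multiplier {A : (Fin K → Fin n) → (Ed d →ₗ[ℝ] Ed N)} (hA : HasConstantRank A)
    (m : ℕ) (hm : m ≠ 0) (i : Fin n) (s : Fin n → ℝ) (hs : s ≠ 0) :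
    ∃ δ > 0, ∃ (C : ℝ) (M : (Fin n → ℤ) → Matrix (Fin d) (Fin d) ℝ),
      IsMult (2 * m : ℕ) ((slopeCell i s δ).indicator 1) C ∧
      (∀ p q, IsMult (2 * m : ℕ) (fun k => M k p q) C) ∧
      (∀ k ∉ slopeCell i s δ, M k = 0) ∧
      (∀ k, ∃ L : Matrix (Fin d) (Fin N) ℝ, M k = L * opMatrix A fun l => (k l : ℝ)) ∧
      ∀ k ∈ slopeCell i s δ, (opMatrix A fun l => (k l : ℝ)) * M k =
        opMatrix A fun l => (k l : ℝ) := by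
  classical
  have hr1 : (1 : ℝ) ≤ (2 * m : ℕ) := by exact_mod_cast (by omega : 1 ≤ 2 * m)
  have hr : (0 : ℝ) < (2 * m : ℕ) := by linarith
  obtain ⟨rk, hrk⟩ := hA
  obtain ⟨B, hB⟩ := exists_isMult_slopeCell m hm n
  obtain ⟨R, hR⟩ := exists_generalized_inverse (opMatrix A s)
  set P : Matrix (Fin d) (Fin d) ℝ := 1 - R * opMatrix A s with hP
  set σ : (Fin n → ℤ) → Fin n → ℝ := fun k j => (k j : ℝ) / k i with hσ
  set Z : (Fin n → ℤ) → Matrix (Fin d) (Fin d) ℝ := fun k => P + R * opMatrix A (σ k) with hZ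
  have gZ : ∀ p q, GermMult (2 * m : ℕ) i s (fun k => Z k p q)
      ((1 : Matrix (Fin d) (Fin d) ℝ) p q) := fun p q => by
    have h1 := (germMult_const (i := i) (s := s) hr (P p q)).add hr1 (GermMult.matrix_mul hr1
      (M := fun _ => R) (M₀ := R) (fun p q => germMult_const hr _)
      (germMult_opMatrix A m hm i s) p q)
    have h2 : P p q + (R * opMatrix A s) p q = (1 : Matrix (Fin d) (Fin d) ℝ) p q := by
      simp [hP]
    rw [h2] at h1
    exact h1
  have gQ : ∀ p q, GermMult (2 * m : ℕ) i s (fun k => ((Z k)⁻¹ * P) p q)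
      (((1 : Matrix (Fin d) (Fin d) ℝ) * P) p q) :=
    GermMult.matrix_mul hr1 (GermMult.matrix_inv hr1 gZ) fun p q => germMult_const hr _
  set W : (Fin n → ℤ) → Matrix (Fin d) (Fin d) ℝ := fun k => 1 - (Z k)⁻¹ * P with hW
  have gW : ∀ p q, ∃ c, GermMult (2 * m : ℕ) i s (fun k => W k p q) c := fun p q => by
    have h1 := (germMult_const hr ((1 : Matrix (Fin d) (Fin d) ℝ) p q)).add hr1
      ((germMult_const hr (-1)).mul hr1 (gQ p q))
    have h2 : (fun k => W k p q) = fun k => (1 : Matrix (Fin d) (Fin d) ℝ) p q +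
        (-1) * ((Z k)⁻¹ * P) p q := by
      funext k
      change (1 - (Z k)⁻¹ * P) p q = _
      rw [Matrix.sub_apply]
      ring
    rw [h2]
    exact ⟨_, h1⟩
  choose c hc using gW
  have ev1 : ∀ᶠ δ in 𝓝[>] (0 : ℝ), ∀ p q, IsMult (2 * m : ℕ)
      ((slopeCell i s δ).indicator fun k => W k p q) (1 + |c p q| * B) :=
    eventually_all.2 fun p => eventually_all.2 fun q =>
      (hc p q).exists_isMult hr1 fun δ hδ => (hB i s δ hδ).1
  have ev2 := GermMult.det hr1 gZ (1 / 2) (by norm_num)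
  obtain ⟨δ, h1, h2, hδ⟩ := (ev1.and (ev2.and self_mem_nhdsWithin)).exists
  replace hδ : 0 < δ := hδ
  have key : ∀ k ∈ slopeCell i s δ, opMatrix A (σ k) * W k = opMatrix A (σ k) ∧
      W k = (Z k)⁻¹ * R * opMatrix A (σ k) := fun k hk => by
    have hki : (k i : ℝ) ≠ 0 := by exact_mod_cast hk.1
    have hσk : σ k ≠ 0 := fun h => by
      have := congrFun h i
      simp [hσ, hki] at this
    have hdet : IsUnit (Z k).det := by
      have h3 := h2.abs_le hr k
      rw [Set.indicator_of_mem hk, Matrix.det_one] at h3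
      change |(Z k).det - 1| ≤ 1 / 2 at h3
      refine isUnit_iff_ne_zero.2 fun h0 => ?_
      rw [h0] at h3
      norm_num at h3
    have h3 := mul_inv_mul_eq_zero hR (A := opMatrix A (σ k))
      (by rw [rank_opMatrix, rank_opMatrix, hrk _ hσk, hrk _ hs]) hdet
    refine ⟨?_, ?_⟩
    · change opMatrix A (σ k) * (1 - (Z k)⁻¹ * P) = _
      rw [Matrix.mul_sub, Matrix.mul_one]
      exact (congrArg (fun X => opMatrix A (σ k) - X) h3).trans (sub_zero _)
    · have h4 : (Z k)⁻¹ * Z k = 1 := Matrix.nonsing_inv_mul _ hdet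
      calc W k = (Z k)⁻¹ * Z k - (Z k)⁻¹ * P := by rw [h4]
        _ = (Z k)⁻¹ * (R * opMatrix A (σ k)) := by
          rw [← Matrix.mul_sub]
          congr 1
          exact add_sub_cancel_left _ _
        _ = _ := (Matrix.mul_assoc _ _ _).symm
  refine ⟨δ, hδ, B + ∑ p, ∑ q, (1 + |c p q| * B), fun k => if k ∈ slopeCell i s δ then W k else 0,
    ?_, fun p q => ?_, fun k hk => if_neg hk, fun k => ?_, fun k hk => ?_⟩
  all_goals have hB0 : 0 ≤ B := ((hB i s δ hδ).1).nonneg hr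
  · exact (hB i s δ hδ).1.mono (le_add_of_nonneg_right (Finset.sum_nonneg fun p _ =>
      Finset.sum_nonneg fun q _ => by positivity))
  · refine ((h1 p q).mono ?_).congr fun k => ?_
    · have e1 : 1 + |c p q| * B ≤ ∑ q, (1 + |c p q| * B) :=
        Finset.single_le_sum (f := fun q => 1 + |c p q| * B) (fun q _ => by positivity)
          (Finset.mem_univ q)
      have e2 : ∑ q, (1 + |c p q| * B) ≤ ∑ p, ∑ q, (1 + |c p q| * B) :=
        Finset.single_le_sum (f := fun p => ∑ q, (1 + |c p q| * B))
          (fun p _ => Finset.sum_nonneg fun q _ => by positivity) (Finset.mem_univ p)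
      linarith
    · by_cases hk : k ∈ slopeCell i s δ <;> simp [hk]
  · by_cases hk : k ∈ slopeCell i s δ
    · have hki : (k i : ℝ) ≠ 0 := by exact_mod_cast hk.1
      refine ⟨((k i : ℝ) ^ K)⁻¹ • ((Z k)⁻¹ * R), ?_⟩
      simp only [if_pos hk]
      rw [opMatrix_intCast_eq A hk.1, Matrix.smul_mul, Matrix.mul_smul, smul_smul,
        inv_mul_cancel₀ (pow_ne_zero _ hki), one_smul]
      exact (key k hk).2
    · exact ⟨0, by simp only [if_neg hk, Matrix.zero_mul]⟩
  · simp only [if_pos hk]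
    rw [opMatrix_intCast_eq A hk.1, Matrix.smul_mul]
    exact congrArg _ (key k hk).1

/-- A bounded parametrix of a symbol of constant rank. -/
lemma exists_symbol_multiplier {A : (Fin K → Fin n) → (Ed d →ₗ[ℝ] Ed N)} (hA : HasConstantRank A)
    (m : ℕ) (hm : m ≠ 0) :
    ∃ (C : ℝ) (M : (Fin n → ℤ) → Matrix (Fin d) (Fin d) ℝ), M 0 = 0 ∧
      (∀ p q, IsMult (2 * m : ℕ) (fun k => M k p q) C) ∧
      (∀ k, ∃ L : Matrix (Fin d) (Fin N) ℝ, M k = L * opMatrix A fun l => (k l : ℝ)) ∧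
      ∀ k, k ≠ 0 → (opMatrix A fun l => (k l : ℝ)) * M k = opMatrix A fun l => (k l : ℝ) := by
  classical
  have hr1 : (1 : ℝ) ≤ (2 * m : ℕ) := by exact_mod_cast (by omega : 1 ≤ 2 * m)
  have hr : (0 : ℝ) < (2 * m : ℕ) := by linarith
  have key := (isCompact_sphere (0 : Dom n) 1).induction_on (p := fun U =>
    ∃ (T : Set (Fin n → ℤ)) (C : ℝ) (M : (Fin n → ℤ) → Matrix (Fin d) (Fin d) ℝ), 0 ∉ T ∧
      (∀ (k : Fin n → ℤ) (t : ℝ), 0 < t → (t • fun l => (k l : ℝ)) ∈ U → k ∈ T) ∧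
      IsMult (2 * m : ℕ) (T.indicator 1) C ∧
      (∀ p q, IsMult (2 * m : ℕ) (fun k => M k p q) C) ∧
      (∀ k ∉ T, M k = 0) ∧
      (∀ k, ∃ L : Matrix (Fin d) (Fin N) ℝ, M k = L * opMatrix A fun l => (k l : ℝ)) ∧
      ∀ k ∈ T, (opMatrix A fun l => (k l : ℝ)) * M k = opMatrix A fun l => (k l : ℝ))
    ?_ ?_ ?_ ?_
  · obtain ⟨T, C, M, h0, hT, -, hM, hM0, hL, hAM⟩ := key
    refine ⟨C, M, hM0 0 h0, hM, hL, fun k hk => hAM k ?_⟩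
    have hk' : (fun l => (k l : ℝ)) ≠ 0 := fun h => hk (funext fun l => by
      have := congrFun h l
      simpa using this)
    have hpos := norm_pos_iff.2 hk'
    refine hT k ‖fun l => (k l : ℝ)‖⁻¹ (inv_pos.2 hpos) ?_
    rw [mem_sphere_zero_iff_norm, norm_smul, norm_inv, norm_norm, inv_mul_cancel₀ hpos.ne']
  · refine ⟨∅, 0, fun _ => 0, by simp, by simp, ?_, fun p q => ?_, by simp,
      fun k => ⟨0, by simp⟩, by simp⟩
    · simpa using (isMult_const (n := n) hr 0).congr fun k => by simp
    · simpa using isMult_const (n := n) hr 0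
  · rintro U V hUV ⟨T, C, M, h0, hT, h⟩
    exact ⟨T, C, M, h0, fun k t ht hk => hT k t ht (hUV hk), h⟩
  · rintro U V ⟨T, C, M, h0, hT, hC, hM, hM0, hL, hAM⟩ ⟨T', C', M', h0', hT', hC', hM', hM0', hL', hAM'⟩
    have hC0 : 0 ≤ C := hC.nonneg hr
    have hC0' : 0 ≤ C' := hC'.nonneg hr
    have hcompl : IsMult (2 * m : ℕ) (fun k => 1 - T.indicator 1 k) (1 + C) := by
      simpa using (isMult_const (n := n) hr 1).sub hr1 hC
    refine ⟨T ∪ T', C + (1 + C) * C', fun k => M k + (1 - T.indicator (1 : (Fin n → ℤ) → ℝ) k) • M' k,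
      by simp [h0, h0'], ?_, ?_, ?_, ?_, ?_, ?_⟩
    · rintro k t ht (hk | hk)
      · exact Or.inl (hT k t ht hk)
      · exact Or.inr (hT' k t ht hk)
    · refine (hC.add hr1 (hcompl.mul hr hC')).congr fun k => ?_
      by_cases hk : k ∈ T <;> by_cases hk' : k ∈ T' <;> simp [hk, hk']
    · exact fun p q => (hM p q).add hr1 (hcompl.mul hr (hM' p q))
    · intro k hk
      rw [Set.mem_union, not_or] at hk
      simp [hM0 k hk.1, hM0' k hk.2]
    · intro k
      obtain ⟨L, hL⟩ := hL k
      obtain ⟨L', hL'⟩ := hL' k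
      refine ⟨L + (1 - T.indicator (1 : (Fin n → ℤ) → ℝ) k) • L', ?_⟩
      simp only [Matrix.add_mul, Matrix.smul_mul, ← hL, ← hL']
    · intro k hk
      by_cases hkT : k ∈ T
      · simp [hkT, hAM k hkT]
      · simp [hkT, hM0 k hkT, hAM' k (hk.resolve_left hkT)]
  · intro ξ hξ
    have hξ0 : ξ ≠ 0 := by
      rintro rfl
      simp at hξ
    obtain ⟨i, hi⟩ := Function.ne_iff.1 hξ0
    simp only [Pi.zero_apply] at hi
    have hs : (fun j => ξ j / ξ i) ≠ 0 := fun h => by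
      have := congrFun h i
      simp [hi] at this
    obtain ⟨δ, hδ, C, M, hC, hM, hM0, hL, hAM⟩ :=
      exists_sector_multiplier hA m hm i (fun j => ξ j / ξ i) hs
    refine ⟨{η | η i ≠ 0 ∧ ∀ j, |η j / η i - ξ j / ξ i| < δ}, ?_, slopeCell i (fun j => ξ j / ξ i) δ,
      C, M, ?_, ?_, hC, hM, hM0, hL, hAM⟩
    · refine mem_nhdsWithin_of_mem_nhds ?_
      have hci : ∀ j, ContinuousAt (fun η : Dom n => η j) ξ := fun j =>
        (continuous_apply j).continuousAt
      have e1 : ∀ᶠ η in 𝓝 ξ, η i ≠ 0 := (hci i).eventually_ne hi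
      have e2 : ∀ᶠ η in 𝓝 ξ, ∀ j, |η j / η i - ξ j / ξ i| < δ := eventually_all.2 fun j => by
        have h1 : ContinuousAt (fun η : Dom n => η j / η i) ξ := (hci j).div (hci i) hi
        exact (Metric.tendsto_nhds.1 h1.tendsto δ hδ)
      exact e1.and e2
    · simp [slopeCell]
    · rintro k t ht ⟨hk1, hk2⟩
      simp only [Pi.smul_apply, smul_eq_mul] at hk1 hk2
      refine ⟨fun h => hk1 (by simp [h]), fun j => ?_⟩
      have h3 := hk2 j
      rw [mul_div_mul_left _ _ ht.ne', abs_lt] at h3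
      constructor <;> linarith [h3.1, h3.2]

end SymbolMultiplier

/-! ### Duality -/

section Duality

variable {n : ℕ}

lemma continuous_norm_rpow_smul {s : ℝ} (hs : -1 < s) :
    Continuous fun z : ℂ => ((‖z‖ ^ s : ℝ) : ℂ) * z := by
  refine continuous_iff_continuousAt.2 fun z => ?_
  rcases eq_or_ne z 0 with rfl | hz
  · rw [ContinuousAt, mul_zero, tendsto_zero_iff_norm_tendsto_zero]
    have h1 : Tendsto (fun z : ℂ => ‖z‖ ^ (s + 1)) (𝓝 0) (𝓝 0) := by
      have h2 : ContinuousAt (fun z : ℂ => ‖z‖ ^ (s + 1)) 0 :=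
        continuous_norm.continuousAt.rpow_const (Or.inr (by linarith))
      have h3 := h2.tendsto
      simpa [Real.zero_rpow (by linarith : s + 1 ≠ 0)] using h3
    refine squeeze_zero (fun _ => norm_nonneg _) (fun z => ?_) h1
    rw [norm_mul, Complex.norm_real, Real.norm_of_nonneg (by positivity)]
    rcases eq_or_ne z 0 with rfl | hz
    · simp [Real.zero_rpow (by linarith : s + 1 ≠ 0)]
    · rw [Real.rpow_add_one (norm_ne_zero_iff.2 hz)]
  · exact (Complex.continuous_ofReal.continuousAt.comp
      (continuous_norm.continuousAt.rpow_const (Or.inl (norm_ne_zero_iff.2 hz)))).mul continuousAt_id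

/-- The `L^p` norm is detected by testing against trigonometric polynomials. -/
lemma boxNorm_le_of_forall_trigPoly {p r : ℝ} (h : p.HolderConjugate r) {f : Dom n → ℂ}
    (hf : Continuous f) (hp : PeriodicZ f) {B : ℝ} (hB : 0 ≤ B)
    (hfB : ∀ (S : Finset (Fin n → ℤ)) (b : (Fin n → ℤ) → ℂ),
      ‖∫ x in unitBox n, f x * (starRingEnd ℂ) (∑ k ∈ S, b k * boxChar k x)‖ ≤
        B * boxNorm r fun x : Dom n => ∑ k ∈ S, b k * boxChar k x) :
    boxNorm p f ≤ B := by
  have hp1 : 1 < p := h.lt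
  have hp0 : 0 < p := h.pos
  have hr1 : 1 < r := h.symm.lt
  have hr0 : 0 < r := h.symm.pos
  set G : Dom n → ℂ := fun x => ((‖f x‖ ^ (p - 2) : ℝ) : ℂ) * f x with hG
  have hGc : Continuous G := (continuous_norm_rpow_smul (by linarith)).comp hf
  have hGp : PeriodicZ G := fun x m => by simp only [hG, hp x m]
  have hGn : ∀ x, ‖G x‖ = ‖f x‖ ^ (p - 1) := fun x => by
    rw [hG]
    simp only [norm_mul, Complex.norm_real]
    rw [Real.norm_of_nonneg (by positivity)]
    rcases eq_or_ne (f x) 0 with h0 | h0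
    · simp [h0, Real.zero_rpow (by linarith : p - 1 ≠ 0)]
    · rw [← Real.rpow_add_one (norm_ne_zero_iff.2 h0)]
      ring_nf
  have hpr : (p - 1) * r = p := h.sub_one_mul_conj
  have hGr : boxNorm r G ^ r = boxNorm p f ^ p := by
    rw [boxNorm_rpow hr0, boxNorm_rpow hp0]
    congr 1 with x
    rw [hGn, ← Real.rpow_mul (norm_nonneg _), hpr]
  have hGr' : boxNorm r G = boxNorm p f ^ (p - 1) := by
    rw [← Real.rpow_left_inj (boxNorm_nonneg _) (Real.rpow_nonneg (boxNorm_nonneg _) _) hr0.ne',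
      hGr, ← Real.rpow_mul (boxNorm_nonneg _), hpr]
  have hfG : ∀ x, f x * (starRingEnd ℂ) (G x) = ((‖f x‖ ^ p : ℝ) : ℂ) := fun x => by
    rw [hG]
    simp only [map_mul, Complex.conj_ofReal]
    rw [mul_left_comm, Complex.mul_conj, ← Complex.ofReal_mul, Complex.normSq_eq_norm_sq]
    rcases eq_or_ne (f x) 0 with h0 | h0
    · simp [h0, Real.zero_rpow hp0.ne']
    · rw [← Real.rpow_natCast, ← Real.rpow_add (norm_pos_iff.2 h0)]
      norm_num
  have hI : ‖∫ x in unitBox n, f x * (starRingEnd ℂ) (G x)‖ = boxNorm p f ^ p := by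
    simp_rw [hfG]
    rw [integral_complex_ofReal, ← boxNorm_rpow hp0, Complex.norm_real,
      Real.norm_of_nonneg (Real.rpow_nonneg (boxNorm_nonneg _) _)]
  have hest : ∀ ε : ℝ, 0 < ε → boxNorm p f ^ p ≤
      B * (boxNorm p f ^ (p - 1) + ε) + boxNorm p f * ε := fun ε hε => by
    obtain ⟨S, b, hSb⟩ := exists_trigPoly_approx hGc hGp hε
    set g : Dom n → ℂ := fun x => ∑ k ∈ S, b k * boxChar k x with hg
    have hgc : Continuous g := continuous_trigPoly S b
    have hd : Continuous fun x => (starRingEnd ℂ) (G x - g x) :=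
      Complex.continuous_conj.comp (hGc.sub hgc)
    have hfg : Continuous fun x => f x * (starRingEnd ℂ) (g x) :=
      hf.mul (Complex.continuous_conj.comp hgc)
    have hfd : Continuous fun x => f x * (starRingEnd ℂ) (G x - g x) := hf.mul hd
    have hgG : Continuous fun x => g x - G x := hgc.sub hGc
    have e1 : ∫ x in unitBox n, f x * (starRingEnd ℂ) (G x) =
        (∫ x in unitBox n, f x * (starRingEnd ℂ) (g x)) +
          ∫ x in unitBox n, f x * (starRingEnd ℂ) (G x - g x) := by
      rw [← integral_add hfg.integrable_box hfd.integrable_box]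
      congr 1 with x
      rw [map_sub]
      ring
    have e2 : boxNorm r g ≤ boxNorm p f ^ (p - 1) + ε := by
      have e3 := boxNorm_add_le hr1.le hGc hgG
      have e4 : boxNorm r (fun x => g x - G x) ≤ ε :=
        boxNorm_le_of_bound hr0 hgG hε.le fun x => by
          rw [norm_sub_rev]
          exact hSb x
      rw [← hGr']
      simp only [add_sub_cancel] at e3
      exact e3.trans (by gcongr)
    have e5 : boxNorm r (fun x => (starRingEnd ℂ) (G x - g x)) ≤ ε :=
      boxNorm_le_of_bound hr0 hd hε.le fun x => by
        rw [RCLike.norm_conj]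
        exact hSb x
    rw [← hI, e1]
    refine (norm_add_le _ _).trans (add_le_add ((hfB S b).trans ?_)
      ((norm_integral_mul_le_boxNorm h hf hd).trans ?_))
    · exact mul_le_mul_of_nonneg_left e2 hB
    · exact mul_le_mul_of_nonneg_left e5 (boxNorm_nonneg _)
  have hlim : boxNorm p f ^ p ≤ B * boxNorm p f ^ (p - 1) := by
    have hc : Continuous fun ε : ℝ => B * (boxNorm p f ^ (p - 1) + ε) + boxNorm p f * ε := by
      fun_prop
    have ht := hc.continuousWithinAt (s := Set.Ioi 0) (x := 0)
    have := ge_of_tendsto ht.tendsto (eventually_mem_nhdsWithin.mono fun ε hε => hest ε hε)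
    simpa using this
  rcases (boxNorm_nonneg (r := p) f).eq_or_lt with h0 | h0
  · rwa [← h0]
  · have h1 : boxNorm p f ^ p = boxNorm p f * boxNorm p f ^ (p - 1) := by
      rw [mul_comm, ← Real.rpow_add_one h0.ne']
      ring_nf
    rw [h1] at hlim
    exact le_of_mul_le_mul_right hlim (Real.rpow_pos_of_pos h0 _)

lemma integral_boxChar_neg_mul_trigPoly (S : Finset (Fin n → ℤ)) (c : (Fin n → ℤ) → ℂ)
    (l : Fin n → ℤ) : ∫ x in unitBox n, boxChar (-l) x * ∑ k ∈ S, c k * boxChar k x =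
      if l ∈ S then c l else 0 := by
  classical
  have h1 : ∀ x : Dom n, boxChar (-l) x * ∑ k ∈ S, c k * boxChar k x =
      ∑ k ∈ S, c k * boxChar (-l + k) x := fun x => by
    rw [Finset.mul_sum]
    refine Finset.sum_congr rfl fun k _ => ?_
    rw [boxChar_add]
    ring
  simp_rw [h1]
  have h3 : ∀ k, Continuous fun x : Dom n => c k * boxChar (-l + k) x := fun k =>
    continuous_const.mul (continuous_boxChar _)
  rw [integral_finsetSum _ fun k _ => (h3 k).integrable_box]
  have h2 : ∀ k ∈ S, ∫ x in unitBox n, c k * boxChar (-l + k) x = if k = l then c l else 0 := by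
    intro k _
    rw [integral_const_mul]
    split_ifs with hk
    · simp [hk, boxChar_zero]
    · rw [integral_boxChar_of_ne_zero, mul_zero]
      intro h0
      exact hk (neg_add_eq_zero.1 h0).symm
  rw [Finset.sum_congr rfl h2, Finset.sum_ite_eq']

lemma integral_mul_conj_trigPoly {f : Dom n → ℂ} (hf : Continuous f) (S : Finset (Fin n → ℤ))
    (b : (Fin n → ℤ) → ℂ) :
    ∫ x in unitBox n, f x * (starRingEnd ℂ) (∑ k ∈ S, b k * boxChar k x) =
      ∑ k ∈ S, (starRingEnd ℂ) (b k) * ∫ x in unitBox n, boxChar (-k) x * f x := by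
  have h1 : ∀ x : Dom n, f x * (starRingEnd ℂ) (∑ k ∈ S, b k * boxChar k x) =
      ∑ k ∈ S, (starRingEnd ℂ) (b k) * (boxChar (-k) x * f x) := fun x => by
    rw [map_sum, Finset.mul_sum]
    refine Finset.sum_congr rfl fun k _ => ?_
    rw [map_mul, boxChar_neg]
    ring
  simp_rw [h1]
  have h3 : ∀ k, Continuous fun x : Dom n => (starRingEnd ℂ) (b k) * (boxChar (-k) x * f x) :=
    fun k => continuous_const.mul ((continuous_boxChar _).mul hf)
  rw [integral_finsetSum _ fun k _ => (h3 k).integrable_box]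
  exact Finset.sum_congr rfl fun k _ => integral_const_mul _ _

end Duality

/-! ### Projection onto `𝒜`-free maps -/

section Projection

variable {n d N K : ℕ}

/-- Multipliers of the form `M(k) = L(k) 𝒜[k]` do not see `𝒜`-free maps: the multiplier applied to
a trigonometric polynomial is controlled by its distance to the `𝒜`-free maps in the dual norm. -/
lemma boxNorm_matrixMultiplier_le {A : (Fin K → Fin n) → (Ed d →ₗ[ℝ] Ed N)} {p r : ℝ}
    (h : p.HolderConjugate r) {M : (Fin n → ℤ) → Matrix (Fin d) (Fin d) ℝ} {C : ℝ} (hC : 0 ≤ C)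
    (hM0 : M 0 = 0) (hM : ∀ i j, IsMult r (fun k => M k i j) C)
    (hL : ∀ k, ∃ L : Matrix (Fin d) (Fin N) ℝ, M k = L * opMatrix A fun l => (k l : ℝ))
    {φ : Dom n → Ed d} (hφ : φ ∈ opTestClass A) (ξ : Ed d) (S : Finset (Fin n → ℤ))
    (c : Fin d → (Fin n → ℤ) → ℂ) (i : Fin d) :
    boxNorm p (fun x : Dom n => ∑ k ∈ S, (∑ j, (M k i j : ℂ) * c j k) * boxChar k x) ≤
      C * ∑ j, boxNorm p fun x : Dom n =>
        (∑ k ∈ S, c j k * boxChar k x) - ((ξ + φ x) j : ℂ) := by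
  classical
  have hr0 : 0 < r := h.symm.pos
  have hφc : ∀ j, Continuous fun x => (φ x j : ℂ) := fun j =>
    Complex.continuous_ofReal.comp (contDiff_coord hφ.1 j).continuous
  have huc : ∀ j, Continuous fun x => (((ξ + φ x) j : ℝ) : ℂ) := fun j => by
    have h1 : Continuous fun x => (ξ j : ℂ) + (φ x j : ℂ) := continuous_const.add (hφc j)
    simpa using h1
  have hwc : ∀ j, Continuous fun x : Dom n => ∑ k ∈ S, c j k * boxChar k x := fun j =>
    continuous_trigPoly S (c j)
  have hdc : ∀ j, Continuous fun x : Dom n =>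
      (∑ k ∈ S, c j k * boxChar k x) - ((ξ + φ x) j : ℂ) := fun j => (hwc j).sub (huc j)
  have hfree : ∀ l : Fin n → ℤ,
      ∑ j, (M l i j : ℂ) * ∫ x in unitBox n, boxChar (-l) x * ((ξ + φ x) j : ℂ) = 0 := by
    intro l
    rcases eq_or_ne l 0 with rfl | hl
    · simp [hM0]
    have h1 : ∀ j, ∫ x in unitBox n, boxChar (-l) x * ((ξ + φ x) j : ℂ) =
        ∫ x in unitBox n, boxChar (-l) x * (φ x j : ℂ) := fun j => by
      have hc1 : Continuous fun x : Dom n => boxChar (-l) x * (ξ j : ℂ) :=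
        (continuous_boxChar _).mul continuous_const
      have hc2 : Continuous fun x : Dom n => boxChar (-l) x * (φ x j : ℂ) :=
        (continuous_boxChar _).mul (hφc j)
      have h2 : ∀ x, boxChar (-l) x * ((ξ + φ x) j : ℂ) =
          boxChar (-l) x * (ξ j : ℂ) + boxChar (-l) x * (φ x j : ℂ) := fun x => by
        simp [mul_add]
      simp_rw [h2]
      rw [integral_add hc1.integrable_box hc2.integrable_box, integral_mul_const,
        integral_boxChar_of_ne_zero (neg_ne_zero.2 hl), zero_mul, zero_add]
    simp_rw [h1]
    obtain ⟨L, hL⟩ := hL l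
    rw [hL]
    simp_rw [Matrix.mul_apply, Complex.ofReal_sum, Finset.sum_mul]
    rw [Finset.sum_comm]
    refine Finset.sum_eq_zero fun a _ => ?_
    have h3 := opMatrix_mul_fourierCoeff_eq_zero hφ l a
    calc _ = (L i a : ℂ) * ∑ j, (opMatrix A (fun l' => (l l' : ℝ)) a j : ℂ) *
          ∫ x in unitBox n, boxChar (-l) x * (φ x j : ℂ) := by
          rw [Finset.mul_sum]
          refine Finset.sum_congr rfl fun j _ => ?_
          rw [Complex.ofReal_mul]
          ring
      _ = 0 := by rw [h3, mul_zero]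
  have hcoeff : ∀ l : Fin n → ℤ, ∫ x in unitBox n, boxChar (-l) x *
      (∑ k ∈ S, (∑ j, (M k i j : ℂ) * c j k) * boxChar k x) =
      ∑ j, (M l i j : ℂ) * ∫ x in unitBox n, boxChar (-l) x *
        ((∑ k ∈ S, c j k * boxChar k x) - ((ξ + φ x) j : ℂ)) := by
    intro l
    have h1 : ∀ j, ∫ x in unitBox n, boxChar (-l) x *
        ((∑ k ∈ S, c j k * boxChar k x) - ((ξ + φ x) j : ℂ)) =
        (if l ∈ S then c j l else 0) -
          ∫ x in unitBox n, boxChar (-l) x * ((ξ + φ x) j : ℂ) := fun j => by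
      have hc1 : Continuous fun x : Dom n => boxChar (-l) x * ∑ k ∈ S, c j k * boxChar k x :=
        (continuous_boxChar _).mul (hwc j)
      have hc2 : Continuous fun x : Dom n => boxChar (-l) x * ((ξ + φ x) j : ℂ) :=
        (continuous_boxChar _).mul (huc j)
      rw [← integral_boxChar_neg_mul_trigPoly S (c j) l,
        ← integral_sub hc1.integrable_box hc2.integrable_box]
      simp_rw [mul_sub]
    simp_rw [h1, mul_sub]
    rw [Finset.sum_sub_distrib, hfree, sub_zero, integral_boxChar_neg_mul_trigPoly]
    split_ifs <;> simp
  refine boxNorm_le_of_forall_trigPoly h (continuous_trigPoly S _) (periodicZ_trigPoly S _)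
    (mul_nonneg hC (Finset.sum_nonneg fun j _ => boxNorm_nonneg _)) fun S' b => ?_
  have hpair : ∫ x in unitBox n, (∑ k ∈ S, (∑ j, (M k i j : ℂ) * c j k) * boxChar k x) *
      (starRingEnd ℂ) (∑ k ∈ S', b k * boxChar k x) =
      ∑ j, ∫ x in unitBox n, ((∑ k ∈ S, c j k * boxChar k x) - ((ξ + φ x) j : ℂ)) *
        (starRingEnd ℂ) (∑ k ∈ S', (M k i j * b k) * boxChar k x) := by
    simp_rw [fun j => integral_mul_conj_trigPoly (hdc j) S' fun k => (M k i j : ℂ) * b k]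
    rw [integral_mul_conj_trigPoly (continuous_trigPoly S _), Finset.sum_comm]
    refine Finset.sum_congr rfl fun l _ => ?_
    rw [hcoeff, Finset.mul_sum]
    refine Finset.sum_congr rfl fun j _ => ?_
    rw [map_mul, Complex.conj_ofReal]
    ring
  rw [hpair]
  refine (norm_sum_le _ _).trans ?_
  rw [mul_right_comm, Finset.mul_sum]
  refine Finset.sum_le_sum fun j _ => ?_
  have hgc : Continuous fun x : Dom n =>
      (starRingEnd ℂ) (∑ k ∈ S', (M k i j * b k) * boxChar k x) :=
    Complex.continuous_conj.comp (continuous_trigPoly S' _)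
  refine (norm_integral_mul_le_boxNorm h (hdc j) hgc).trans ?_
  have h1 : boxNorm r (fun x : Dom n =>
      (starRingEnd ℂ) (∑ k ∈ S', (M k i j * b k) * boxChar k x)) =
      boxNorm r fun x : Dom n => ∑ k ∈ S', (M k i j * b k) * boxChar k x := by
    simp only [boxNorm, RCLike.norm_conj]
  rw [h1, mul_comm]
  exact mul_le_mul_of_nonneg_right (hM i j S' b) (boxNorm_nonneg _)

/-- Simultaneous approximation of the coordinates of a periodic map. -/
lemma exists_trigPoly_approx_coord {v : Fin d → Dom n → ℂ} (hv : ∀ j, Continuous (v j))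
    (hp : ∀ j, PeriodicZ (v j)) {ε : ℝ} (hε : 0 < ε) :
    ∃ (S : Finset (Fin n → ℤ)) (c : Fin d → (Fin n → ℤ) → ℂ),
      ∀ j x, ‖(∑ k ∈ S, c j k * boxChar k x) - v j x‖ ≤ ε := by
  classical
  choose S c hS using fun j => exists_trigPoly_approx (hv j) (hp j) hε
  refine ⟨Finset.univ.biUnion S, fun j k => if k ∈ S j then c j k else 0, fun j x => ?_⟩
  rw [norm_sub_rev]
  refine (congrArg (fun z => ‖v j x - z‖) ?_).trans_le (hS j x)
  simp only [ite_mul, zero_mul]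
  rw [← Finset.sum_filter, Finset.filter_mem_eq_inter,
    Finset.inter_eq_right.2 (Finset.subset_biUnion_of_mem S (Finset.mem_univ j))]

/-- A continuous retraction onto a ball containing `K` moves points by at most their distance
to `K`. -/
lemma exists_retraction_dist_le {K : Set (Ed d)} (hne : K.Nonempty) {R : ℝ} (hR : 0 < R)
    (hK : ∀ y ∈ K, ‖y‖ ≤ R) : ∃ ρ : Ed d → Ed d, Continuous ρ ∧ (∀ x, ‖ρ x‖ ≤ R) ∧
      ∀ x, ‖ρ x - x‖ ≤ Metric.infDist x K := by
  have hpos : ∀ x : Ed d, 0 < max R ‖x‖ := fun x => lt_max_of_lt_left hR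
  refine ⟨fun x => (R / max R ‖x‖) • x, ?_, fun x => ?_, fun x => ?_⟩
  · exact (continuous_const.div (continuous_const.max continuous_norm) fun x =>
      (hpos x).ne').smul continuous_id
  · rw [norm_smul, Real.norm_of_nonneg (div_nonneg hR.le (hpos x).le), div_mul_eq_mul_div,
      div_le_iff₀ (hpos x)]
    exact mul_le_mul_of_nonneg_left (le_max_right _ _) hR.le
  · refine (Metric.le_infDist hne).2 fun y hy => ?_
    change ‖(R / max R ‖x‖) • x - x‖ ≤ dist x y
    rcases le_total ‖x‖ R with hx | hx
    · rw [max_eq_left hx, div_self hR.ne', one_smul, sub_self, norm_zero]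
      exact dist_nonneg
    · have hx0 : 0 < ‖x‖ := hR.trans_le hx
      have e1 : (R / ‖x‖) • x - x = (R / ‖x‖ - 1) • x := by rw [sub_smul, one_smul]
      rw [max_eq_right hx, e1, norm_smul, Real.norm_eq_abs, abs_of_nonpos (by
        rw [sub_nonpos, div_le_one hx0]
        exact hx), neg_sub, sub_mul, div_mul_cancel₀ _ hx0.ne', one_mul, dist_eq_norm]
      have := norm_sub_norm_le x y
      linarith [hK y hy]

end Projection

/-! ### Quasiconvex hulls -/

section Hull

variable {n d N k : ℕ}

lemma norm_le_sum_norm_coord (x : Ed d) : ‖x‖ ≤ ∑ i, |x i| := by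
  conv_lhs => rw [← (EuclideanSpace.basisFun (Fin d) ℝ).sum_repr x]
  refine (norm_sum_le _ _).trans (le_of_eq (Finset.sum_congr rfl fun i _ => ?_))
  rw [norm_smul, OrthonormalBasis.norm_eq_one, mul_one]
  simp

lemma continuous_infDist_add (K : Set (Ed d)) (ξ : Ed d) {φ : Dom n → Ed d} (hφ : Continuous φ) :
    Continuous fun x => Metric.infDist (ξ + φ x) K :=
  (Metric.continuous_infDist_pt K).comp (continuous_const.add hφ)

/-- A test map that is close to `K` in `L^p` can be replaced by one that is close to `K` in `L^p`
and bounded in `L^r`. -/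
lemma exists_truncated_test {A : (Fin k → Fin n) → (Ed d →ₗ[ℝ] Ed N)} (hA : HasConstantRank A)
    {K : Set (Ed d)} (hne : K.Nonempty) (hK : Bornology.IsBounded K) {m : ℕ} (hm : m ≠ 0) {p : ℝ}
    (h : p.HolderConjugate (2 * m : ℕ)) (ξ : Ed d) :
    ∃ C : ℝ, 0 ≤ C ∧ ∀ ε, 0 < ε → ε ≤ 1 → ∀ φ ∈ opTestClass A,
      boxNorm p (fun x => Metric.infDist (ξ + φ x) K) ≤ ε →
      ∃ ψ ∈ opTestClass A, boxNorm p (fun x => Metric.infDist (ξ + ψ x) K) ≤ C * ε ∧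
        boxNorm (2 * m : ℕ) (fun x => Metric.infDist (ξ + ψ x) K) ≤ C := by
  classical
  have hp1 : 1 ≤ p := h.lt.le
  have hp0 : 0 < p := h.pos
  obtain ⟨r, hr⟩ : ∃ r : ℝ, r = (2 * m : ℕ) := ⟨_, rfl⟩
  obtain ⟨C₀, M, hM0, hM, hL, hAM⟩ := exists_symbol_multiplier hA m hm
  rw [← hr] at h hM ⊢
  have hr1 : 1 ≤ r := h.symm.lt.le
  have hr0 : 0 < r := h.symm.pos
  set C := |C₀| with hC_def
  have hC : 0 ≤ C := abs_nonneg _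
  replace hM : ∀ i j, IsMult r (fun k => M k i j) C := fun i j => (hM i j).mono (le_abs_self C₀)
  obtain ⟨R₀, hR₀⟩ := hK.exists_norm_le
  set R := |R₀| + 1 with hR_def
  have hR : 0 < R := by positivity
  have hKR : ∀ y ∈ K, ‖y‖ ≤ R := fun y hy => (hR₀ y hy).trans ((le_abs_self _).trans (by simp [R]))
  obtain ⟨ρ, hρc, hρR, hρd⟩ := exists_retraction_dist_le hne hR hKR
  refine ⟨max (1 + d * (4 + C * (d * 2))) (R + d * (‖ξ‖ + 2 * (R + 1) + d * (C * (R + 1)))),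
    le_max_of_le_left (by positivity), fun ε hε hε1 φ hφ hφε => ?_⟩
  set D : Dom n → ℝ := fun x => Metric.infDist (ξ + φ x) K with hD
  have hφc : Continuous φ := hφ.1.continuous
  have hDc : Continuous D := continuous_infDist_add K ξ hφc
  have hD0 : ∀ x, 0 ≤ D x := fun x => Metric.infDist_nonneg
  have hvc : ∀ j, Continuous fun x => (ρ (ξ + φ x) j : ℂ) := fun j =>
    Complex.continuous_ofReal.comp ((EuclideanSpace.proj (𝕜 := ℝ) j).continuous.comp
      (hρc.comp (continuous_const.add hφc)))
  have hvp : ∀ j, PeriodicZ fun x => (ρ (ξ + φ x) j : ℂ) := fun j x z => by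
    simp only [hφ.2.1 x z]
  obtain ⟨S, c, hw⟩ := exists_trigPoly_approx_coord hvc hvp hε
  set w : Fin d → Dom n → ℂ := fun j x => ∑ l ∈ S, c j l * boxChar l x with hw_def
  set g : Fin d → Dom n → ℂ := fun i x => ∑ l ∈ S, (∑ j, (M l i j : ℂ) * c j l) * boxChar l x
    with hg_def
  have hwc : ∀ j, Continuous (w j) := fun j => continuous_trigPoly S (c j)
  have hgc : ∀ i, Continuous (g i) := fun i => continuous_trigPoly S _
  have hDR : ∀ x, D x = ‖D x‖ := fun x => (Real.norm_of_nonneg (hD0 x)).symm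
  have hu_coord : ∀ j, Continuous fun x => (((ξ + φ x) j : ℝ) : ℂ) := fun j =>
    Complex.continuous_ofReal.comp ((EuclideanSpace.proj (𝕜 := ℝ) j).continuous.comp
      (continuous_const.add hφc))
  have hwu : ∀ j x, ‖w j x - ((ξ + φ x) j : ℂ)‖ ≤ ε + D x := fun j x => by
    have h1 : ‖(ρ (ξ + φ x) j : ℂ) - ((ξ + φ x) j : ℂ)‖ ≤ D x := by
      rw [← Complex.ofReal_sub, Complex.norm_real, ← PiLp.sub_apply]
      exact (PiLp.norm_apply_le _ _).trans (hρd _)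
    exact (norm_sub_le_norm_sub_add_norm_sub _ _ _).trans (add_le_add (hw j x) h1)
  have hwR : ∀ j x, ‖w j x‖ ≤ R + 1 := fun j x => by
    have h1 : ‖(ρ (ξ + φ x) j : ℂ)‖ ≤ R := by
      rw [Complex.norm_real]
      exact (PiLp.norm_apply_le _ _).trans (hρR _)
    have h2 := norm_sub_norm_le (w j x) (ρ (ξ + φ x) j : ℂ)
    linarith [hw j x]
  have hεD : boxNorm p (fun x => ε + D x) ≤ 2 * ε := by
    refine (boxNorm_add_le hp1 continuous_const hDc).trans ?_
    rw [boxNorm_const hp0, Real.norm_of_nonneg hε.le]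
    linarith
  have hwu_norm : ∀ j, boxNorm p (fun x => w j x - ((ξ + φ x) j : ℂ)) ≤ 2 * ε := fun j =>
    (boxNorm_mono hp0 ((hwc j).sub (hu_coord j)) (continuous_const.add hDc) fun x =>
      (hwu j x).trans (le_abs_self _)).trans hεD
  have hg_p : ∀ i, boxNorm p (g i) ≤ C * (d * (2 * ε)) := fun i => by
    refine (boxNorm_matrixMultiplier_le h hC hM0 hM hL hφ ξ S c i).trans
      (mul_le_mul_of_nonneg_left ?_ hC)
    refine (Finset.sum_le_sum fun j _ => hwu_norm j).trans (le_of_eq ?_)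
    simp
  have hg_r : ∀ i, boxNorm r (g i) ≤ d * (C * (R + 1)) := fun i => by
    have h1 : g i = fun x => ∑ j, ∑ l ∈ S, ((M l i j : ℂ) * c j l) * boxChar l x := by
      funext x
      simp only [hg_def, Finset.sum_mul]
      exact Finset.sum_comm
    rw [h1]
    refine (boxNorm_sum_le hr1 _ fun j => continuous_trigPoly S _).trans ?_
    refine (Finset.sum_le_sum fun j _ => (hM i j S (c j)).trans (mul_le_mul_of_nonneg_left
      (boxNorm_le_of_bound hr0 (hwc j) (by positivity) (hwR j)) hC)).trans (le_of_eq ?_)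
    simp
  set w₀ : Fin d → ℂ := fun j => ∫ x in unitBox n, w j x with hw₀_def
  have hw₀R : ∀ j, ‖w₀ j‖ ≤ R + 1 := fun j =>
    (norm_integral_le_boxNorm le_rfl (hwc j)).trans
      (boxNorm_le_of_bound one_pos (hwc j) (by positivity) (hwR j))
  have hξw₀ : ∀ j, ‖w₀ j - (ξ j : ℂ)‖ ≤ 2 * ε := fun j => by
    have h1 : ∫ x in unitBox n, (((ξ + φ x) j : ℝ) : ℂ) = (ξ j : ℂ) := by
      have h2 : ∫ x in unitBox n, φ x j = 0 := by
        have h3 := (EuclideanSpace.proj (𝕜 := ℝ) j).integral_comp_comm hφc.integrable_box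
        rw [hφ.2.2.2] at h3
        simpa using h3
      have hc1 : Continuous fun x => φ x j := (contDiff_coord hφ.1 j).continuous
      rw [integral_complex_ofReal]
      simp only [PiLp.add_apply]
      rw [integral_add (integrable_const _) hc1.integrable_box, h2]
      simp
    have hc2 : Continuous fun x => w j x - ((ξ + φ x) j : ℂ) := (hwc j).sub (hu_coord j)
    rw [← h1, hw₀_def, ← integral_sub (hwc j).integrable_box (hu_coord j).integrable_box]
    exact (norm_integral_le_boxNorm hp1 hc2).trans (hwu_norm j)
  set c' : Fin d → (Fin n → ℤ) → ℂ := fun i l => c i l - ∑ j, (M l i j : ℂ) * c j l with hc'_def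
  set ψ : Dom n → Ed d := fun x =>
    WithLp.toLp 2 fun j => (∑ l ∈ S.erase 0, c' j l * boxChar l x).re with hψ_def
  have hψ : ψ ∈ opTestClass A := by
    refine trigPoly_mem_opTestClass (Finset.notMem_erase 0 S) c' fun l hl i => ?_
    have hl0 := (Finset.mem_erase.1 hl).1
    have h1 : ∀ j, ∑ i', (opMatrix A (fun l' => (l l' : ℝ)) i i' : ℂ) * (M l i' j : ℂ) =
        (opMatrix A (fun l' => (l l' : ℝ)) i j : ℂ) := fun j => by
      have h2 := congrFun (congrFun (hAM l hl0) i) j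
      rw [Matrix.mul_apply] at h2
      exact_mod_cast h2
    simp only [hc'_def, mul_sub, Finset.sum_sub_distrib, Finset.mul_sum]
    rw [Finset.sum_comm, sub_eq_zero]
    refine Finset.sum_congr rfl fun j _ => ?_
    rw [← h1 j, Finset.sum_mul]
    exact Finset.sum_congr rfl fun i' _ => mul_assoc _ _ _
  have hψw : ∀ j x, ψ x j = (w j x - w₀ j - g j x).re := fun j x => by
    have h0 : w₀ j = if (0 : Fin n → ℤ) ∈ S then c j 0 else 0 := by
      rw [← integral_boxChar_neg_mul_trigPoly S (c j) 0]
      simp only [neg_zero, boxChar_zero, one_mul, hw₀_def, hw_def]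
    have h1 : w j x - g j x = ∑ l ∈ S, c' j l * boxChar l x := by
      simp only [hw_def, hg_def, hc'_def, sub_mul, Finset.sum_sub_distrib]
    have h2 : ∑ l ∈ S.erase 0, c' j l * boxChar l x = w j x - w₀ j - g j x := by
      rw [sub_right_comm, h1, h0]
      split_ifs with hS
      · rw [← Finset.add_sum_erase S _ hS]
        simp [hc'_def, hM0, boxChar_zero]
      · rw [Finset.erase_eq_of_notMem hS, sub_zero]
    simp only [hψ_def, h2]
  have hψc : Continuous ψ := hψ.1.continuous
  have hEc : Continuous fun x => Metric.infDist (ξ + ψ x) K := continuous_infDist_add K ξ hψc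
  refine ⟨ψ, hψ, ?_, ?_⟩
  · have hpt : ∀ x, Metric.infDist (ξ + ψ x) K ≤
        D x + ∑ i, ((ε + D x) + (2 * ε + ‖g i x‖)) := fun x => by
      have h1 : Metric.infDist (ξ + ψ x) K ≤ D x + dist (ξ + ψ x) (ξ + φ x) :=
        Metric.infDist_le_infDist_add_dist
      refine h1.trans (add_le_add le_rfl ?_)
      rw [dist_eq_norm]
      refine (norm_le_sum_norm_coord _).trans (Finset.sum_le_sum fun i _ => ?_)
      have h2 : (ξ + ψ x - (ξ + φ x)) i =
          ((w i x - ((ξ + φ x) i : ℂ)) - ((w₀ i - (ξ i : ℂ)) + g i x)).re := by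
        simp only [PiLp.sub_apply, PiLp.add_apply, hψw, Complex.sub_re, Complex.add_re,
          Complex.ofReal_re]
        ring
      rw [h2]
      refine (Complex.abs_re_le_norm _).trans ((norm_sub_le _ _).trans (add_le_add (hwu i x) ?_))
      exact (norm_add_le _ _).trans (add_le_add (hξw₀ i) le_rfl)
    have hc1 : ∀ i, Continuous fun x => (2 * ε + ‖g i x‖) := fun i =>
      continuous_const.add (hgc i).norm
    have hc2 : Continuous fun x => ε + D x := continuous_const.add hDc
    have hc3 : ∀ i, Continuous fun x => (ε + D x) + (2 * ε + ‖g i x‖) := fun i => hc2.add (hc1 i)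
    have hc4 : Continuous fun x => ∑ i, ((ε + D x) + (2 * ε + ‖g i x‖)) :=
      continuous_finsetSum _ fun i _ => hc3 i
    have hsum : ∀ i, boxNorm p (fun x => (ε + D x) + (2 * ε + ‖g i x‖)) ≤
        2 * ε + (2 * ε + C * (d * (2 * ε))) := fun i => by
      refine (boxNorm_add_le hp1 hc2 (hc1 i)).trans (add_le_add hεD ?_)
      refine (boxNorm_add_le hp1 continuous_const (hgc i).norm).trans (add_le_add ?_ ?_)
      · rw [boxNorm_const hp0, Real.norm_of_nonneg (by positivity)]
      · rw [boxNorm_norm]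
        exact hg_p i
    calc boxNorm p (fun x => Metric.infDist (ξ + ψ x) K)
        ≤ boxNorm p (fun x => D x + ∑ i, ((ε + D x) + (2 * ε + ‖g i x‖))) :=
          boxNorm_mono hp0 hEc (hDc.add hc4) fun x => by
            rw [Real.norm_of_nonneg Metric.infDist_nonneg]
            exact (hpt x).trans (le_abs_self _)
      _ ≤ ε + ∑ _i : Fin d, (2 * ε + (2 * ε + C * (d * (2 * ε)))) :=
          (boxNorm_add_le hp1 hDc hc4).trans (add_le_add hφε
            ((boxNorm_sum_le hp1 _ hc3).trans (Finset.sum_le_sum fun i _ => hsum i)))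
      _ = (1 + d * (4 + C * (d * 2))) * ε := by
          rw [Finset.sum_const, Finset.card_univ, Fintype.card_fin, nsmul_eq_mul]
          ring
      _ ≤ _ := mul_le_mul_of_nonneg_right (le_max_left _ _) hε.le
  · have hpt : ∀ x, Metric.infDist (ξ + ψ x) K ≤
        R + ∑ i, ((‖ξ‖ + 2 * (R + 1)) + ‖g i x‖) := fun x => by
      obtain ⟨y, hy⟩ := hne
      refine (Metric.infDist_le_dist_of_mem hy).trans ?_
      rw [dist_comm, dist_eq_norm]
      refine (norm_sub_le _ _).trans (add_le_add (hKR y hy) ?_)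
      refine (norm_le_sum_norm_coord _).trans (Finset.sum_le_sum fun i _ => ?_)
      rw [PiLp.add_apply, hψw]
      have h1 : |ξ i| ≤ ‖ξ‖ := PiLp.norm_apply_le ξ i
      have h2 : |(w i x - w₀ i - g i x).re| ≤ ‖w i x‖ + ‖w₀ i‖ + ‖g i x‖ :=
        (Complex.abs_re_le_norm _).trans ((norm_sub_le _ _).trans
          (add_le_add (norm_sub_le _ _) le_rfl))
      have h3 := abs_add_le (ξ i) (w i x - w₀ i - g i x).re
      linarith [hwR i x, hw₀R i]
    have hc3 : ∀ i, Continuous fun x => (‖ξ‖ + 2 * (R + 1)) + ‖g i x‖ := fun i =>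
      continuous_const.add (hgc i).norm
    have hc4 : Continuous fun x => ∑ i, ((‖ξ‖ + 2 * (R + 1)) + ‖g i x‖) :=
      continuous_finsetSum _ fun i _ => hc3 i
    have hsum : ∀ i, boxNorm r (fun x => (‖ξ‖ + 2 * (R + 1)) + ‖g i x‖) ≤
        (‖ξ‖ + 2 * (R + 1)) + d * (C * (R + 1)) := fun i => by
      refine (boxNorm_add_le hr1 continuous_const (hgc i).norm).trans (add_le_add ?_ ?_)
      · rw [boxNorm_const hr0, Real.norm_of_nonneg (by positivity)]
      · rw [boxNorm_norm]
        exact hg_r i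
    calc boxNorm r (fun x => Metric.infDist (ξ + ψ x) K)
        ≤ boxNorm r (fun x => R + ∑ i, ((‖ξ‖ + 2 * (R + 1)) + ‖g i x‖)) :=
          boxNorm_mono hr0 hEc (continuous_const.add hc4) fun x => by
            rw [Real.norm_of_nonneg Metric.infDist_nonneg]
            exact (hpt x).trans (le_abs_self _)
      _ ≤ R + ∑ _i : Fin d, ((‖ξ‖ + 2 * (R + 1)) + d * (C * (R + 1))) := by
          refine (boxNorm_add_le hr1 continuous_const hc4).trans (add_le_add ?_
            ((boxNorm_sum_le hr1 _ hc3).trans (Finset.sum_le_sum fun i _ => hsum i)))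
          rw [boxNorm_const hr0, Real.norm_of_nonneg hR.le]
      _ = R + d * (‖ξ‖ + 2 * (R + 1) + d * (C * (R + 1))) := by
          rw [Finset.sum_const, Finset.card_univ, Fintype.card_fin, nsmul_eq_mul]
      _ ≤ _ := le_max_right _ _

lemma zero_mem_opTestClass (A : (Fin k → Fin n) → (Ed d →ₗ[ℝ] Ed N)) :
    (fun _ => 0) ∈ opTestClass A := by
  have h := trigPoly_mem_opTestClass (A := A) (Finset.notMem_empty 0) (fun _ _ => 0) (by simp)
  convert h using 1
  funext x
  ext j
  simp

lemma mem_opHull_iff {A : (Fin k → Fin n) → (Ed d →ₗ[ℝ] Ed N)} {K : Set (Ed d)} {p : ℝ}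
    (hp : 0 < p) {ξ : Ed d} : ξ ∈ opHull A K p ↔ ∀ ε, 0 < ε → ∃ φ ∈ opTestClass A,
      boxNorm p (fun x => Metric.infDist (ξ + φ x) K) < ε := by
  set I : (Dom n → Ed d) → ℝ := fun φ => ∫ x in unitBox n, Metric.infDist (ξ + φ x) K ^ p with hI
  have hI' : ∀ φ, boxNorm p (fun x => Metric.infDist (ξ + φ x) K) ^ p = I φ := fun φ => by
    rw [boxNorm_rpow hp]
    simp only [Real.norm_of_nonneg Metric.infDist_nonneg, hI]
  have hI0 : ∀ φ, 0 ≤ I φ := fun φ => by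
    rw [← hI']
    exact Real.rpow_nonneg (boxNorm_nonneg _) _
  have hne : (I '' opTestClass A).Nonempty := ⟨_, _, zero_mem_opTestClass A, rfl⟩
  have hbdd : BddBelow (I '' opTestClass A) := ⟨0, by
    rintro _ ⟨φ, -, rfl⟩
    exact hI0 φ⟩
  have hinf : ξ ∈ opHull A K p ↔ sInf (I '' opTestClass A) = 0 := Iff.rfl
  rw [hinf]
  constructor
  · intro h0 ε hε
    have h1 : sInf (I '' opTestClass A) < ε ^ p := by
      rw [h0]
      positivity
    obtain ⟨_, ⟨φ, hφ, rfl⟩, h2⟩ := exists_lt_of_csInf_lt hne h1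
    refine ⟨φ, hφ, ?_⟩
    rw [← hI'] at h2
    exact (Real.rpow_lt_rpow_iff (boxNorm_nonneg _) hε.le hp).1 h2
  · intro h
    refine le_antisymm (le_of_forall_pos_le_add fun ε hε => ?_) (le_csInf hne ?_)
    · obtain ⟨φ, hφ, h1⟩ := h (ε ^ p⁻¹) (by positivity)
      refine (csInf_le hbdd ⟨φ, hφ, rfl⟩).trans ?_
      rw [zero_add, ← hI' φ]
      refine (Real.rpow_le_rpow (boxNorm_nonneg _) h1.le hp.le).trans (le_of_eq ?_)
      exact Real.rpow_inv_rpow hε.le hp.ne'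
    · rintro _ ⟨φ, -, rfl⟩
      exact hI0 φ

lemma opHull_anti {A : (Fin k → Fin n) → (Ed d →ₗ[ℝ] Ed N)} {K : Set (Ed d)} {p q : ℝ}
    (hp : 0 < p) (hpq : p ≤ q) : opHull A K q ⊆ opHull A K p := by
  intro ξ hξ
  rw [mem_opHull_iff (hp.trans_le hpq)] at hξ
  refine (mem_opHull_iff hp).2 fun ε hε => ?_
  obtain ⟨φ, hφ, h⟩ := hξ ε hε
  exact ⟨φ, hφ, (boxNorm_le_of_exponent_le hp hpq
    (continuous_infDist_add K ξ hφ.1.continuous)).trans_lt h⟩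

lemma opHull_subset_opHull_midpoint {A : (Fin k → Fin n) → (Ed d →ₗ[ℝ] Ed N)}
    (hA : HasConstantRank A) {K : Set (Ed d)} (hne : K.Nonempty) (hK : Bornology.IsBounded K)
    {m : ℕ} (hm : m ≠ 0) {p : ℝ} (h : p.HolderConjugate (2 * m : ℕ)) :
    opHull A K p ⊆ opHull A K ((p + (2 * m : ℕ)) / 2) := by
  intro ξ hξ
  have hp0 : 0 < p := h.pos
  have hr0 : 0 < ((2 * m : ℕ) : ℝ) := h.symm.pos
  have hs0 : 0 < (p + (2 * m : ℕ)) / 2 := by linarith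
  obtain ⟨C, hC, hCε⟩ := exists_truncated_test hA hne hK hm h ξ
  rw [mem_opHull_iff hp0] at hξ
  refine (mem_opHull_iff hs0).2 fun η hη => ?_
  have hlim : Tendsto (fun ε : ℝ => (C * ε) ^ (p / 2) * C ^ (((2 * m : ℕ) : ℝ) / 2)) (𝓝[>] 0)
      (𝓝 0) := by
    have hc : Continuous fun ε : ℝ => (C * ε) ^ (p / 2) * C ^ (((2 * m : ℕ) : ℝ) / 2) :=
      ((continuous_const.mul continuous_id).rpow_const fun _ => Or.inr (by positivity)).mul
        continuous_const
    have h1 := (hc.tendsto 0).mono_left (nhdsWithin_le_nhds (s := Set.Ioi 0))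
    simpa [Real.zero_rpow (by positivity : p / 2 ≠ 0)] using h1
  have hηs : 0 < η ^ ((p + (2 * m : ℕ)) / 2) := Real.rpow_pos_of_pos hη _
  obtain ⟨ε, hε, hε0, hε1⟩ := ((hlim.eventually_lt_const hηs).and
    (eventually_mem_nhdsWithin.and
      (mem_nhdsWithin_of_mem_nhds (Iic_mem_nhds one_pos)))).exists
  replace hε0 : 0 < ε := hε0
  obtain ⟨φ, hφ, hφε⟩ := hξ ε hε0
  obtain ⟨ψ, hψ, h1, h2⟩ := hCε ε hε0 hε1 φ hφ hφε.le
  refine ⟨ψ, hψ, (Real.rpow_lt_rpow_iff (boxNorm_nonneg _) hη.le hs0).1 (lt_of_le_of_lt ?_ hε)⟩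
  rw [boxNorm_rpow hs0]
  refine (integral_rpow_midpoint_le hp0 hr0 (continuous_infDist_add K ξ hψ.1.continuous)).trans ?_
  exact mul_le_mul (Real.rpow_le_rpow (boxNorm_nonneg _) h1 (by positivity))
    (Real.rpow_le_rpow (boxNorm_nonneg _) h2 (by positivity))
    (Real.rpow_nonneg (boxNorm_nonneg _) _) (Real.rpow_nonneg (mul_nonneg hC hε0.le) _)

end Hull

end

/-- For a constant-rank operator `𝒜` and a non-empty compact
`K ⊆ ℝ^d`, the `p`- and `q`-`𝒜`-quasiconvex hulls of `K` coincide for all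
`1 < p < q < ∞`. -/
theorem opHull_eq_of_constant_rank (n d N k : ℕ)
    (A : (Fin k → Fin n) → (Ed d →ₗ[ℝ] Ed N)) (hA : HasConstantRank A)
    (K : Set (Ed d)) (hne : K.Nonempty) (hcomp : IsCompact K)
    (p q : ℝ) (hp : 1 < p) (hpq : p < q) :
    opHull A K p = opHull A K q := by
  refine Set.Subset.antisymm ?_ (opHull_anti (by linarith) hpq.le)
  obtain ⟨m, hm⟩ := exists_nat_ge (q + p / (2 * (p - 1)))
  have hp' : 0 < p / (2 * (p - 1)) := div_pos (by linarith) (by linarith)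
  have hmq : q ≤ m := by linarith
  have hm1 : (1 : ℝ) < m := by linarith
  have hm0 : m ≠ 0 := by
    rintro rfl
    norm_num at hm1
  have hr : (1 : ℝ) < (2 * m : ℕ) := by
    push_cast
    linarith
  have h : (Real.conjExponent (2 * m : ℕ)).HolderConjugate (2 * m : ℕ) :=
    (Real.HolderConjugate.conjExponent hr).symm
  have hle : Real.conjExponent (2 * m : ℕ) ≤ p := by
    have h1 : p / (2 * (p - 1)) ≤ m := by linarith
    rw [div_le_iff₀ (by linarith)] at h1
    rw [Real.conjExponent, div_le_iff₀ (by linarith)]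
    push_cast
    nlinarith
  refine (opHull_anti h.pos hle).trans ((opHull_subset_opHull_midpoint hA hne
    hcomp.isBounded hm0 h).trans (opHull_anti (by linarith) ?_))
  have := h.pos
  push_cast at this ⊢
  linarith
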